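/- arXiv:2202.01632 — 2 statements merged into one kernel-verified Lean document; each statement's English description precedes it below -/
import Mathlib

section
/- Every Martin-Löf random sequence x ∈ Ω^ℕ is Poisson generic. -/
open MeasureTheory Filter

/-- The uniform product measure μ^k on Ω^k, Ω = Fin b: normalized counting measure. -/
noncomputable def muK (b k : ℕ) : Measure (Fin k → Fin b) :=
  ((b : ENNReal) ^ k)⁻¹ • Measure.count

/-- ν is the product measure μ^ℕ of uniform measures on Ω = Fin b over Ω^ℕ:
every cylinder of length n has measure b^{-n}. -/
def IsUnifProductMeasure (b : ℕ) (ν : Measure (ℕ → Fin b)) : Prop :=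
  ∀ (n : ℕ) (w : Fin n → Fin b),
    ν {x | ∀ t : Fin n, x (t : ℕ) = w t} = ((b : ENNReal)⁻¹) ^ n

/-- The word w (of length k) occurs in x at position j (positions numbered from 1):
I_j(x,w) = 1. -/
def OccursAt {b k : ℕ} (x : ℕ → Fin b) (j : ℕ) (w : Fin k → Fin b) : Prop :=
  ∀ t : Fin k, x (j - 1 + (t : ℕ)) = w t

instance {b k : ℕ} (x : ℕ → Fin b) (j : ℕ) (w : Fin k → Fin b) :
    Decidable (OccursAt x j w) := by unfold OccursAt; infer_instance

/-- M_k^x(S)(w) = Σ_{j ∈ ℕ ∩ b^k S} I_j(x,w): the number of positive integers j with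
j/b^k ∈ S at which w occurs in x. -/
noncomputable def Mx (b k : ℕ) (S : Set ℝ) (x : ℕ → Fin b) (w : Fin k → Fin b) : ℕ :=
  {j : ℕ | 1 ≤ j ∧ ((j : ℝ) / (b : ℝ) ^ k) ∈ S ∧ OccursAt x j w}.ncard

/-- Z^λ_{i,k}(x): proportion of words of length k occurring exactly i times
among positions 1 ≤ j ≤ λ b^k of x. -/
noncomputable def Z (b k i : ℕ) (lam : ℝ) (x : ℕ → Fin b) : ℝ :=
  ((Finset.univ.filter (fun w : Fin k → Fin b =>
      ((Finset.Icc 1 ⌊lam * (b : ℝ) ^ k⌋₊).filter (fun j => OccursAt x j w)).card = i)).card : ℝ)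
    / (b : ℝ) ^ k

/-- x is λ-Poisson generic. -/
def LamPoissonGeneric (b : ℕ) (lam : ℝ) (x : ℕ → Fin b) : Prop :=
  ∀ i : ℕ, Tendsto (fun k : ℕ => Z b k i lam x) atTop
    (nhds (Real.exp (-lam) * lam ^ i / (Nat.factorial i : ℝ)))

/-- x is Poisson generic. -/
def PoissonGeneric (b : ℕ) (x : ℕ → Fin b) : Prop :=
  ∀ lam : ℝ, 0 < lam → LamPoissonGeneric b lam x

/-- S ⊆ [0,∞) is a finite union of pairwise disjoint intervals with rational endpoints. -/
def IsFinRatIntervalUnion (S : Set ℝ) : Prop :=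
  ∃ (n : ℕ) (p q : Fin n → ℚ), (∀ m, 0 ≤ p m) ∧
    (Pairwise fun m l : Fin n =>
      Disjoint (Set.Ioo ((p m : ℝ)) ((q m : ℝ))) (Set.Ioo ((p l : ℝ)) ((q l : ℝ)))) ∧
    S = ⋃ m, Set.Ioo ((p m : ℝ)) ((q m : ℝ))

/-- Total variation distance between two laws on ℕ (given as set functions). -/
noncomputable def dTV (P Q : Set ℕ → ℝ) : ℝ := ⨆ A : Set ℕ, |P A - Q A|

/-- The law on ℕ of M_k(S) under μ^ℕ × μ^k. -/
noncomputable def lawM (b k : ℕ) (ν : Measure (ℕ → Fin b)) (S : Set ℝ) (A : Set ℕ) : ℝ :=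
  ((ν.prod (muK b k)) {p : (ℕ → Fin b) × (Fin k → Fin b) | Mx b k S p.1 p.2 ∈ A}).toReal

/-- The law on ℕ of M_k^x(S) under μ^k. -/
noncomputable def lawMx (b k : ℕ) (x : ℕ → Fin b) (S : Set ℝ) (A : Set ℕ) : ℝ :=
  ((muK b k) {w : Fin k → Fin b | Mx b k S x w ∈ A}).toReal

/-- The Poisson law with mean λ, as a set function on ℕ. -/
noncomputable def poissonLaw (lam : ℝ) (A : Set ℕ) : ℝ :=
  ∑' i : A, Real.exp (-lam) * lam ^ (i : ℕ) / (Nat.factorial (i : ℕ) : ℝ)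

/-- The basic open cylinder B_w ⊆ Ω^ℕ of sequences starting with the finite word w. -/
def Cyl {b : ℕ} (w : List (Fin b)) : Set (ℕ → Fin b) :=
  {x | ∀ i : Fin w.length, x (i : ℕ) = w.get i}

/-- A Martin-Löf test: a uniformly computable sequence of open sets (each a computable
union of basic cylinders) with μ^ℕ(O_n) ≤ 2^{-n}. -/
def MLTest (b : ℕ) (ν : Measure (ℕ → Fin b)) (O : ℕ → Set (ℕ → Fin b)) : Prop :=
  (∃ f : ℕ → ℕ → List (Fin b), Computable₂ f ∧ ∀ n, O n = ⋃ i : ℕ, Cyl (f n i)) ∧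
  ∀ n : ℕ, ν (O n) ≤ ((2 : ENNReal)⁻¹) ^ n

/-- x is Martin-Löf random (w.r.t. the uniform product measure ν): it fails every
Martin-Löf test. -/
def MLRandom (b : ℕ) (ν : Measure (ℕ → Fin b)) (x : ℕ → Fin b) : Prop :=
  ∀ O : ℕ → Set (ℕ → Fin b), MLTest b ν O → x ∉ ⋂ n : ℕ, O n

/-- Bounded-difference form of the Efron–Stein inequality for the uniform measure on `α ^ n`. -/
theorem sum_sq_sub_mean_le_of_bounded_differences {α : Type*} [Fintype α] [Nonempty α] (c : ℝ) :
    ∀ (n : ℕ) (f : (Fin n → α) → ℝ),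
      (∀ (u v : Fin n → α) (s : Fin n), (∀ r, r ≠ s → u r = v r) → |f u - f v| ≤ c) →
      ∑ u, (f u - (∑ v, f v) / (Fintype.card α : ℝ) ^ n) ^ 2 ≤
        (Fintype.card α : ℝ) ^ n * (n * c ^ 2) := by
  have hq : (0 : ℝ) < Fintype.card α := by exact_mod_cast Fintype.card_pos
  intro n
  induction n with
  | zero =>
    intro f _
    simp
  | succ n ih =>
    intro f hf
    obtain ⟨q, hq_def⟩ : ∃ q : ℝ, q = (Fintype.card α : ℝ) := ⟨_, rfl⟩
    simp only [← hq_def] at hq ih ⊢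
    have hsplit : ∀ g : (Fin (n + 1) → α) → ℝ,
        ∑ u, g u = ∑ a, ∑ u : Fin n → α, g (Fin.cons a u) := by
      intro g
      rw [← Fintype.sum_prod_type']
      exact (Equiv.sum_comp (Fin.consEquiv fun _ => α) g).symm
    set m : α → ℝ := fun a => (∑ u : Fin n → α, f (Fin.cons a u)) / q ^ n with hm
    set M : ℝ := (∑ v, f v) / q ^ (n + 1) with hM
    have hsum : ∀ a, ∑ u : Fin n → α, f (Fin.cons a u) = q ^ n * m a := by
      intro a
      rw [hm]
      field_simp
    have hMm : ∑ a, m a = q * M := by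
      rw [hM, hsplit, Finset.sum_congr rfl fun a _ => hsum a, ← Finset.mul_sum]
      field_simp
      ring
    have hm_diff : ∀ a a', |m a - m a'| ≤ c := by
      intro a a'
      have h : m a - m a' =
          (∑ u : Fin n → α, (f (Fin.cons a u) - f (Fin.cons a' u))) / q ^ n := by
        rw [hm, Finset.sum_sub_distrib, sub_div]
      rw [h, abs_div, abs_of_pos (pow_pos hq n), div_le_iff₀ (pow_pos hq n)]
      refine (Finset.abs_sum_le_sum_abs _ _).trans ?_
      calc ∑ u : Fin n → α, |f (Fin.cons a u) - f (Fin.cons a' u)|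
          ≤ ∑ _u : Fin n → α, c := by
            refine Finset.sum_le_sum fun u _ => hf _ _ 0 fun r hr => ?_
            obtain ⟨r, rfl⟩ := Fin.exists_succ_eq.2 hr
            simp
        _ = c * q ^ n := by simp [hq_def, mul_comm]
    have hmM : ∀ a, |m a - M| ≤ c := by
      intro a
      have h : m a - M = (∑ a', (m a - m a')) / q := by
        rw [Finset.sum_sub_distrib, hMm]
        simp only [Finset.sum_const, Finset.card_univ, nsmul_eq_mul, ← hq_def]
        field_simp
      rw [h, abs_div, abs_of_pos hq, div_le_iff₀ hq]
      refine (Finset.abs_sum_le_sum_abs _ _).trans ?_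
      calc ∑ a', |m a - m a'| ≤ ∑ _a' : α, c := Finset.sum_le_sum fun a' _ => hm_diff a a'
        _ = c * q := by simp [hq_def, mul_comm]
    have hslice : ∀ a, ∑ u : Fin n → α, (f (Fin.cons a u) - M) ^ 2 ≤
        q ^ n * (n * c ^ 2) + q ^ n * c ^ 2 := by
      intro a
      have hvar := ih (fun u => f (Fin.cons a u)) fun u v s huv => hf _ _ s.succ fun r hr => by
        refine Fin.cases (fun _ => by simp) (fun r hr => ?_) r hr
        simpa using huv r fun h => hr (by rw [h])
      have hexp : ∑ u : Fin n → α, (f (Fin.cons a u) - M) ^ 2 =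
          ∑ u : Fin n → α, (f (Fin.cons a u) - m a) ^ 2 + q ^ n * (m a - M) ^ 2 := by
        have h : ∀ u : Fin n → α, (f (Fin.cons a u) - M) ^ 2 =
            (f (Fin.cons a u) - m a) ^ 2 + 2 * (m a - M) * f (Fin.cons a u) +
              ((m a - M) ^ 2 - 2 * (m a - M) * m a) := fun u => by ring
        rw [Finset.sum_congr rfl fun u _ => h u, Finset.sum_add_distrib, Finset.sum_add_distrib,
          ← Finset.mul_sum, hsum]
        simp only [Finset.sum_const, Finset.card_univ, nsmul_eq_mul, Fintype.card_fun,
          Fintype.card_fin, Nat.cast_pow, ← hq_def]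
        ring
      have hsq : (m a - M) ^ 2 ≤ c ^ 2 := sq_le_sq' (abs_le.1 (hmM a)).1 (abs_le.1 (hmM a)).2
      rw [hexp]
      exact add_le_add hvar (mul_le_mul_of_nonneg_left hsq (pow_pos hq n).le)
    rw [hsplit]
    refine (Finset.sum_le_sum fun a _ => hslice a).trans (le_of_eq ?_)
    simp only [Finset.sum_const, Finset.card_univ, nsmul_eq_mul, ← hq_def]
    push_cast
    ring

section Blocks

open Finset

variable {α : Type*}

/-- The block of length `k` of `y` starting at the (zero-based) position `p`. -/
def block (y : ℕ → α) (k p : ℕ) : Fin k → α := fun t => y (p + t)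

theorem block_congr {y z : ℕ → α} {k p : ℕ} (h : ∀ s, p ≤ s → s < p + k → y s = z s) :
    block y k p = block z k p :=
  funext fun t => h _ (by omega) (by omega)

variable [Fintype α] [DecidableEq α]

/-- The number of occurrences of `w` in `y` that start before position `N`. -/
def occCount (y : ℕ → α) (k N : ℕ) (w : Fin k → α) : ℕ :=
  #{p ∈ range N | block y k p = w}

/-- The words of length `k` with exactly `i` occurrences in `y` starting before `N`. -/
def occClass (y : ℕ → α) (k N i : ℕ) : Finset (Fin k → α) :=
  {w | occCount y k N w = i}

/-- The defect in the recursion `(i + 1) a (i + 1) = λ a i` satisfied by Poisson weights. -/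
noncomputable def steinDefect (y : ℕ → α) (k N i : ℕ) : ℝ :=
  ((i : ℝ) + 1) * #(occClass y k N (i + 1)) * (Fintype.card α : ℝ) ^ k - N * #(occClass y k N i)

theorem occClass_congr {y z : ℕ → α} {k N : ℕ} (h : ∀ s < N + k, y s = z s) (i : ℕ) :
    occClass y k N i = occClass z k N i := by
  have hocc : ∀ w, occCount y k N w = occCount z k N w := fun w => by
    unfold occCount
    congr 1
    refine filter_congr fun p hp => ?_
    rw [mem_range] at hp
    rw [block_congr fun s _ hs => h s (by omega)]
  simp only [occClass, hocc]

theorem steinDefect_congr {y z : ℕ → α} {k N : ℕ} (h : ∀ s < N + k, y s = z s) (i : ℕ) :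
    steinDefect y k N i = steinDefect z k N i := by
  simp only [steinDefect, occClass_congr h]

theorem mul_card_occClass (y : ℕ → α) (k N i : ℕ) :
    i * #(occClass y k N i) = #{p ∈ range N | occCount y k N (block y k p) = i} := by
  have hmaps : Set.MapsTo (block y k)
      ({p ∈ range N | occCount y k N (block y k p) = i} : Finset ℕ) (occClass y k N i) := by
    intro p hp
    simpa [occClass] using (mem_filter.1 (mem_coe.1 hp)).2
  rw [card_eq_sum_card_fiberwise hmaps, sum_const_nat (m := i), mul_comm]
  intro w hw
  have hw' : occCount y k N w = i := by simpa [occClass] using hw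
  rw [← hw', filter_filter]
  unfold occCount
  congr 1
  refine filter_congr fun p _ => ⟨fun h => h.2, fun h => ⟨?_, h⟩⟩
  rw [h]

theorem sum_occCount (y : ℕ → α) (k N : ℕ) : ∑ w, occCount y k N w = N := by
  have h := card_eq_sum_card_fiberwise (f := block y k) (s := range N) (t := univ)
    fun p _ => by simp
  rw [card_range] at h
  exact h.symm

theorem card_occClass_le_add {y z : ℕ → α} {s : ℕ} (h : ∀ r, r ≠ s → y r = z r) (k N i : ℕ) :
    #(occClass y k N i) ≤ #(occClass z k N i) + 2 * k := by
  set near : Finset ℕ := {p ∈ range (s + 1) | s < p + k} with hnear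
  have hcard : #near ≤ k := by
    calc #near ≤ #(Finset.Ico (s + 1 - k) (s + 1)) := card_le_card fun p hp => by
          simp only [hnear, mem_filter, mem_range] at hp
          simp only [Finset.mem_Ico]
          omega
      _ ≤ k := by simp only [Nat.card_Ico]; omega
  set T := near.image (block y k) ∪ near.image (block z k) with hT
  have hTcard : #T ≤ 2 * k := by
    have h1 := card_union_le (near.image (block y k)) (near.image (block z k))
    have h2 := card_image_le (s := near) (f := block y k)
    have h3 := card_image_le (s := near) (f := block z k)
    rw [hT]
    omega
  have hsub : occClass y k N i ⊆ occClass z k N i ∪ T := by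
    intro w hw
    by_cases hwT : w ∈ T
    · exact mem_union_right _ hwT
    refine mem_union_left _ ?_
    have hw' : occCount y k N w = i := by simpa [occClass] using hw
    suffices occCount z k N w = occCount y k N w by simp [occClass, this, hw']
    unfold occCount
    congr 1
    refine filter_congr fun p _ => ?_
    by_cases hp : p ∈ near
    · have h1 : block y k p ≠ w := fun h => hwT (mem_union_left _ (mem_image.2 ⟨p, hp, h⟩))
      have h2 : block z k p ≠ w := fun h => hwT (mem_union_right _ (mem_image.2 ⟨p, hp, h⟩))
      simp [h1, h2]
    · rw [block_congr fun r hr1 hr2 => h r ?_]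
      rintro rfl
      exact hp (by simp only [hnear, mem_filter, mem_range]; omega)
  exact (card_le_card hsub).trans ((card_union_le _ _).trans (by omega))

theorem abs_card_occClass_sub_le {y z : ℕ → α} {s : ℕ} (h : ∀ r, r ≠ s → y r = z r)
    (k N i : ℕ) : |(#(occClass y k N i) : ℝ) - #(occClass z k N i)| ≤ 2 * k := by
  have h1 : (#(occClass y k N i) : ℝ) ≤ #(occClass z k N i) + 2 * k := by
    exact_mod_cast card_occClass_le_add h k N i
  have h2 : (#(occClass z k N i) : ℝ) ≤ #(occClass y k N i) + 2 * k := by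
    exact_mod_cast card_occClass_le_add (fun r hr => (h r hr).symm) k N i
  rw [abs_le]
  constructor <;> linarith

theorem abs_steinDefect_sub_le {y z : ℕ → α} {s : ℕ} (h : ∀ r, r ≠ s → y r = z r)
    (k N i : ℕ) : |steinDefect y k N i - steinDefect z k N i| ≤
      2 * k * ((i + 1) * (Fintype.card α : ℝ) ^ k + N) := by
  have h1 := abs_card_occClass_sub_le h k N (i + 1)
  have h2 := abs_card_occClass_sub_le h k N i
  have heq : steinDefect y k N i - steinDefect z k N i =
      ((i + 1) * (Fintype.card α : ℝ) ^ k) *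
        ((#(occClass y k N (i + 1)) : ℝ) - #(occClass z k N (i + 1))) -
      N * ((#(occClass y k N i) : ℝ) - #(occClass z k N i)) := by
    unfold steinDefect
    ring
  rw [heq]
  refine (abs_sub _ _).trans ?_
  rw [abs_mul _ ((#(occClass y k N (i + 1)) : ℝ) - _), abs_mul (N : ℝ),
    abs_of_nonneg (a := ((i : ℝ) + 1) * (Fintype.card α : ℝ) ^ k) (by positivity),
    abs_of_nonneg (a := (N : ℝ)) (by positivity)]
  have h3 := mul_le_mul_of_nonneg_left h1
    (show (0 : ℝ) ≤ ((i : ℝ) + 1) * (Fintype.card α : ℝ) ^ k by positivity)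
  have h4 := mul_le_mul_of_nonneg_left h2 (show (0 : ℝ) ≤ N by positivity)
  linarith

/-- The positions before `N` whose blocks of length `k` meet the block at `p`. -/
def nearPositions (N k p : ℕ) : Finset ℕ := {p' ∈ range N | p' < p + k ∧ p < p' + k}

theorem card_nearPositions_le (N k p : ℕ) : #(nearPositions N k p) ≤ 2 * k := by
  calc #(nearPositions N k p) ≤ #(Finset.Ico (p + 1 - k) (p + k)) := card_le_card fun q hq => by
        simp only [nearPositions, mem_filter, mem_range] at hq
        simp only [Finset.mem_Ico]
        omega
    _ ≤ 2 * k := by simp only [Nat.card_Ico]; omega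

end Blocks

section Overwrite

open Finset

variable {α : Type*} [Inhabited α] {L : ℕ}

/-- Extension of a finite word by a default symbol. -/
def extendWord (u : Fin L → α) : ℕ → α := fun s => if h : s < L then u ⟨s, h⟩ else default

/-- The word `u` with the block of length `k` at position `p` replaced by `w`. -/
def overwrite {k : ℕ} (u : Fin L → α) (p : ℕ) (w : Fin k → α) : Fin L → α :=
  fun s => if h : p ≤ (s : ℕ) ∧ (s : ℕ) < p + k then w ⟨s - p, by omega⟩ else u s

theorem extendWord_val (u : Fin L → α) (s : Fin L) : extendWord u s = u s := by
  simp [extendWord]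

theorem block_overwrite_self {k p : ℕ} (hp : p + k ≤ L) (u : Fin L → α) (w : Fin k → α) :
    block (extendWord (overwrite u p w)) k p = w := by
  funext t
  have h : p + (t : ℕ) < L := by omega
  simp [block, extendWord, overwrite, h]

theorem extendWord_overwrite_of_notMem {k p s : ℕ} (u : Fin L → α) (w : Fin k → α)
    (hs : ¬ (p ≤ s ∧ s < p + k)) : extendWord (overwrite u p w) s = extendWord u s := by
  unfold extendWord overwrite
  split_ifs <;> rfl

theorem overwrite_overwrite_block {k p : ℕ} (u : Fin L → α) (w : Fin k → α) :
    overwrite (overwrite u p w) p (block (extendWord u) k p) = u := by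
  funext s
  unfold overwrite
  split_ifs with h
  · have hs : p + ((s : ℕ) - p) = s := by omega
    simp [block, hs, extendWord_val]
  · rfl

theorem occCount_overwrite [DecidableEq α] {k N p : ℕ} (hp : p < N) (hL : p + k ≤ L) (u : Fin L → α)
    (w : Fin k → α)
    (h₁ : ∀ q ∈ nearPositions N k p, block (extendWord u) k q ≠ w)
    (h₂ : ∀ q ∈ nearPositions N k p, q ≠ p → block (extendWord (overwrite u p w)) k q ≠ w)
    (hk : 0 < k) :
    occCount (extendWord (overwrite u p w)) k N w = occCount (extendWord u) k N w + 1 := by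
  have hpnear : p ∈ nearPositions N k p := by
    simp only [nearPositions, mem_filter, mem_range]
    omega
  have hnot : p ∉ ({q ∈ range N | block (extendWord u) k q = w} : Finset ℕ) := fun h =>
    h₁ p hpnear (mem_filter.1 h).2
  unfold occCount
  rw [← card_insert_of_notMem hnot]
  congr 1
  ext q
  simp only [mem_filter, mem_insert]
  by_cases hqp : q = p
  · subst hqp
    simp [hp, block_overwrite_self hL]
  by_cases hq : q ∈ nearPositions N k p
  · simp [hqp, h₁ q hq, h₂ q hq hqp]
  · have hfar : q ∈ range N →
        block (extendWord (overwrite u p w)) k q = block (extendWord u) k q := fun hqN =>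
      block_congr fun s hs₁ hs₂ => extendWord_overwrite_of_notMem u w fun hs =>
        hq (by
          simp only [nearPositions, mem_filter]
          exact ⟨hqN, by omega⟩)
    constructor
    · rintro ⟨hqN, h⟩
      exact Or.inr ⟨hqN, hfar hqN ▸ h⟩
    · rintro (h | ⟨hqN, h⟩)
      · exact absurd h hqp
      · exact ⟨hqN, (hfar hqN).trans h⟩

theorem abs_indicator_overwrite_sub_le [DecidableEq α] {k N p : ℕ} (i : ℕ) (hp : p < N) (hL : p + k ≤ L)
    (hk : 0 < k) (u : Fin L → α) (w : Fin k → α) :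
    |(if occCount (extendWord (overwrite u p w)) k N w = i + 1 then (1 : ℝ) else 0) -
      (if occCount (extendWord u) k N w = i then 1 else 0)| ≤
    ∑ q ∈ nearPositions N k p, ((if block (extendWord u) k q = w then (1 : ℝ) else 0) +
      (if q ≠ p ∧ block (extendWord (overwrite u p w)) k q = w then 1 else 0)) := by
  have hnonneg : ∀ q ∈ nearPositions N k p,
      (0 : ℝ) ≤ (if block (extendWord u) k q = w then (1 : ℝ) else 0) +
        (if q ≠ p ∧ block (extendWord (overwrite u p w)) k q = w then 1 else 0) := by
    intro q _
    positivity
  by_cases h : ∃ q ∈ nearPositions N k p, block (extendWord u) k q = w ∨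
      (q ≠ p ∧ block (extendWord (overwrite u p w)) k q = w)
  · obtain ⟨q, hq, hqw⟩ := h
    calc _ ≤ (1 : ℝ) := by split_ifs <;> norm_num
      _ ≤ (if block (extendWord u) k q = w then (1 : ℝ) else 0) +
          (if q ≠ p ∧ block (extendWord (overwrite u p w)) k q = w then 1 else 0) := by
        rcases hqw with hqw | hqw
        · rw [if_pos hqw]
          split_ifs <;> norm_num
        · rw [if_pos hqw]
          split_ifs <;> norm_num
      _ ≤ _ := single_le_sum hnonneg hq
  · push Not at h
    rw [occCount_overwrite hp hL u w (fun q hq => (h q hq).1) (fun q hq => (h q hq).2) hk]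
    simpa using sum_nonneg hnonneg

variable [Fintype α]

theorem sum_overwrite {M : Type*} [AddCommMonoid M] {k p : ℕ} (hp : p + k ≤ L)
    (g : (Fin L → α) → M) :
    ∑ u : Fin L → α, ∑ w : Fin k → α, g (overwrite u p w) =
      (Fintype.card α ^ k) • ∑ u, g u := by
  let swap : (Fin L → α) × (Fin k → α) → (Fin L → α) × (Fin k → α) := fun a =>
    (overwrite a.1 p a.2, block (extendWord a.1) k p)
  have hswap : Function.Involutive swap := fun a =>
    Prod.ext (overwrite_overwrite_block a.1 a.2) (block_overwrite_self hp a.1 a.2)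
  calc ∑ u : Fin L → α, ∑ w : Fin k → α, g (overwrite u p w)
      = ∑ a : (Fin L → α) × (Fin k → α), g (swap a).1 :=
        (Fintype.sum_prod_type fun a : (Fin L → α) × (Fin k → α) => g (swap a).1).symm
    _ = ∑ a : (Fin L → α) × (Fin k → α), g a.1 :=
        Equiv.sum_comp hswap.toPerm fun a => g a.1
    _ = (Fintype.card α ^ k) • ∑ u, g u := by
        rw [Fintype.sum_prod_type]
        simp [Finset.smul_sum]

variable [DecidableEq α]

theorem card_block_eq_block_mul_le_of_lt {k p p' : ℕ} (hlt : p < p') (hp' : p' + k ≤ L) :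
    #{u : Fin L → α | block (extendWord u) k p = block (extendWord u) k p'} *
      Fintype.card α ^ k ≤ Fintype.card α ^ L := by
  set S : Finset (Fin L → α) :=
    {u | block (extendWord u) k p = block (extendWord u) k p'} with hS
  have hinj : Set.InjOn (fun a : (Fin L → α) × (Fin k → α) => overwrite a.1 p' a.2)
      (S ×ˢ (univ : Finset (Fin k → α)) : Finset _) := by
    rintro ⟨u, w⟩ hu ⟨v, w'⟩ hv heq
    simp only [coe_product, coe_univ, Set.mem_prod, mem_coe, Set.mem_univ, and_true] at hu hv
    simp only at heq
    have hw : w = w' := by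
      rw [← block_overwrite_self hp' u w, heq, block_overwrite_self hp']
    have hper : ∀ u ∈ S, ∀ t, t < k → extendWord u (p' + t) = extendWord u (p + t) := by
      intro u hu t ht
      simp only [hS, mem_filter, mem_univ, true_and] at hu
      exact (congrFun hu ⟨t, ht⟩).symm
    have hext : ∀ s, extendWord u s = extendWord v s := by
      intro s
      induction s using Nat.strong_induction_on with
      | _ s ih =>
        by_cases hs : p' ≤ s ∧ s < p' + k
        · obtain ⟨t, rfl⟩ := Nat.exists_eq_add_of_le hs.1
          rw [hper u hu t (by omega), hper v hv t (by omega)]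
          exact ih _ (by omega)
        · rw [← extendWord_overwrite_of_notMem u w hs, heq, extendWord_overwrite_of_notMem v w' hs]
    refine Prod.ext (funext fun s => ?_) hw
    have := hext s
    rwa [extendWord_val, extendWord_val] at this
  have hcard := card_le_card_of_injOn (t := univ) _ (fun _ _ => mem_coe.2 (mem_univ _)) hinj
  simpa [card_product] using hcard

theorem card_block_eq_block_mul_le {k p p' : ℕ} (hne : p ≠ p') (hp : p + k ≤ L)
    (hp' : p' + k ≤ L) :
    #{u : Fin L → α | block (extendWord u) k p = block (extendWord u) k p'} *
      Fintype.card α ^ k ≤ Fintype.card α ^ L := by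
  rcases lt_or_gt_of_ne hne with h | h
  · exact card_block_eq_block_mul_le_of_lt h hp'
  · simpa only [eq_comm] using card_block_eq_block_mul_le_of_lt (α := α) h hp

theorem sum_abs_indicator_overwrite_sub_le {k N p : ℕ} (i : ℕ) (hp : p < N) (hL : N + k ≤ L)
    (hk : 0 < k) :
    ∑ u : Fin L → α, ∑ w : Fin k → α,
      |(if occCount (extendWord (overwrite u p w)) k N w = i + 1 then (1 : ℝ) else 0) -
        (if occCount (extendWord u) k N w = i then 1 else 0)| ≤
    4 * k * (Fintype.card α : ℝ) ^ L := by
  have hnear : ∀ q ∈ nearPositions N k p, ∑ u : Fin L → α, ∑ w : Fin k → α,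
      ((if block (extendWord u) k q = w then (1 : ℝ) else 0) +
        (if q ≠ p ∧ block (extendWord (overwrite u p w)) k q = w then 1 else 0)) ≤
      2 * (Fintype.card α : ℝ) ^ L := by
    intro q hq
    have hqN : q < N := mem_range.1 (mem_filter.1 hq).1
    simp only [sum_add_distrib]
    have h1 : ∑ u : Fin L → α, ∑ w : Fin k → α,
        (if block (extendWord u) k q = w then (1 : ℝ) else 0) = (Fintype.card α : ℝ) ^ L := by
      simp
    have h2 : ∑ u : Fin L → α, ∑ w : Fin k → α,
        (if q ≠ p ∧ block (extendWord (overwrite u p w)) k q = w then (1 : ℝ) else 0) ≤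
          (Fintype.card α : ℝ) ^ L := by
      by_cases hqp : q = p
      · simp [hqp]
      have hrw : ∀ (u : Fin L → α) (w : Fin k → α),
          (if q ≠ p ∧ block (extendWord (overwrite u p w)) k q = w then (1 : ℝ) else 0) =
          (fun v : Fin L → α => if block (extendWord v) k q = block (extendWord v) k p
            then (1 : ℝ) else 0) (overwrite u p w) := by
        intro u w
        simp only [block_overwrite_self (show p + k ≤ L by omega), ne_eq, hqp, not_false_eq_true,
          true_and]
      rw [sum_congr rfl fun u _ => sum_congr rfl fun w _ => hrw u w,
        sum_overwrite (by omega) fun v : Fin L → α =>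
          if block (extendWord v) k q = block (extendWord v) k p then (1 : ℝ) else 0,
        sum_boole, nsmul_eq_mul, mul_comm]
      exact_mod_cast card_block_eq_block_mul_le (α := α) hqp (by omega) (by omega)
    linarith
  calc _ ≤ ∑ u : Fin L → α, ∑ w : Fin k → α, ∑ q ∈ nearPositions N k p,
        ((if block (extendWord u) k q = w then (1 : ℝ) else 0) +
        (if q ≠ p ∧ block (extendWord (overwrite u p w)) k q = w then 1 else 0)) :=
        sum_le_sum fun u _ => sum_le_sum fun w _ =>
          abs_indicator_overwrite_sub_le i hp (by omega) hk u w
    _ = ∑ q ∈ nearPositions N k p, ∑ u : Fin L → α, ∑ w : Fin k → α,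
        ((if block (extendWord u) k q = w then (1 : ℝ) else 0) +
        (if q ≠ p ∧ block (extendWord (overwrite u p w)) k q = w then 1 else 0)) := by
        rw [sum_comm (s := nearPositions N k p)]
        exact sum_congr rfl fun u _ => sum_comm
    _ ≤ ∑ _q ∈ nearPositions N k p, 2 * (Fintype.card α : ℝ) ^ L := sum_le_sum hnear
    _ = #(nearPositions N k p) * (2 * (Fintype.card α : ℝ) ^ L) := by
        rw [sum_const, nsmul_eq_mul]
    _ ≤ (2 * k) * (2 * (Fintype.card α : ℝ) ^ L) := by
        gcongr
        exact_mod_cast card_nearPositions_le N k p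
    _ = 4 * k * (Fintype.card α : ℝ) ^ L := by ring

theorem abs_sum_steinDefect_le {k N : ℕ} (i : ℕ) (hL : N + k ≤ L) (hk : 0 < k) :
    |∑ u : Fin L → α, steinDefect (extendWord u) k N i| ≤
      N * (4 * k * (Fintype.card α : ℝ) ^ L) := by
  have hfst : ∑ u : Fin L → α, ((i : ℝ) + 1) * #(occClass (extendWord u) k N (i + 1)) *
      (Fintype.card α : ℝ) ^ k = ∑ p ∈ range N, ∑ u : Fin L → α, ∑ w : Fin k → α,
        (if occCount (extendWord (overwrite u p w)) k N w = i + 1 then (1 : ℝ) else 0) := by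
    have hcard : ∀ u : Fin L → α, ((i : ℝ) + 1) * #(occClass (extendWord u) k N (i + 1)) =
        ∑ p ∈ range N,
          if occCount (extendWord u) k N (block (extendWord u) k p) = i + 1 then (1 : ℝ) else 0 := by
      intro u
      rw [sum_boole]
      exact_mod_cast mul_card_occClass (extendWord u) k N (i + 1)
    rw [← sum_mul, sum_congr rfl fun u _ => hcard u, sum_comm, sum_mul]
    refine sum_congr rfl fun p hp => ?_
    have hpL : p + k ≤ L := by
      have := mem_range.1 hp
      omega
    have h := sum_overwrite (α := α) hpL fun v =>
      if occCount (extendWord v) k N (block (extendWord v) k p) = i + 1 then (1 : ℝ) else 0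
    simp only [block_overwrite_self hpL] at h
    rw [h, nsmul_eq_mul, mul_comm, Nat.cast_pow]
  have hsnd : ∑ u : Fin L → α, (N : ℝ) * #(occClass (extendWord u) k N i) =
      ∑ p ∈ range N, ∑ u : Fin L → α, ∑ w : Fin k → α,
        (if occCount (extendWord u) k N w = i then (1 : ℝ) else 0) := by
    rw [sum_const, card_range, nsmul_eq_mul, mul_sum]
    refine sum_congr rfl fun u _ => ?_
    rw [sum_boole]
    rfl
  have hdiff : ∑ u : Fin L → α, steinDefect (extendWord u) k N i =
      ∑ p ∈ range N, ∑ u : Fin L → α, ∑ w : Fin k → α,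
        ((if occCount (extendWord (overwrite u p w)) k N w = i + 1 then (1 : ℝ) else 0) -
          (if occCount (extendWord u) k N w = i then 1 else 0)) := by
    simp only [steinDefect, sum_sub_distrib]
    rw [hfst, hsnd]
  rw [hdiff]
  calc _ ≤ ∑ p ∈ range N, 4 * k * (Fintype.card α : ℝ) ^ L := by
        refine (abs_sum_le_sum_abs _ _).trans (sum_le_sum fun p hp => ?_)
        refine le_trans ?_ (sum_abs_indicator_overwrite_sub_le i (mem_range.1 hp) hL hk)
        refine (abs_sum_le_sum_abs _ _).trans (sum_le_sum fun u _ => ?_)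
        exact abs_sum_le_sum_abs _ _
    _ = N * (4 * k * (Fintype.card α : ℝ) ^ L) := by
        rw [sum_const, card_range, nsmul_eq_mul]

theorem sum_sq_steinDefect_le {k N : ℕ} (i : ℕ) (hL : N + k ≤ L) (hk : 0 < k) :
    ∑ u : Fin L → α, steinDefect (extendWord u) k N i ^ 2 ≤
      (Fintype.card α : ℝ) ^ L *
        (L * (2 * k * ((i + 1) * (Fintype.card α : ℝ) ^ k + N)) ^ 2 + (4 * k * N) ^ 2) := by
  have hq : (0 : ℝ) < (Fintype.card α : ℝ) ^ L :=
    pow_pos (by exact_mod_cast Fintype.card_pos) L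
  set f : (Fin L → α) → ℝ := fun u => steinDefect (extendWord u) k N i with hf
  have hvar := sum_sq_sub_mean_le_of_bounded_differences
    (2 * k * ((i + 1) * (Fintype.card α : ℝ) ^ k + N)) L f fun u v s huv =>
      abs_steinDefect_sub_le (s := s) (fun r hr => by
        unfold extendWord
        split_ifs with h
        · exact huv _ fun hrs => hr (by rw [← hrs])
        · rfl) k N i
  have hmean := abs_sum_steinDefect_le (α := α) i hL hk
  change |∑ u, f u| ≤ _ at hmean
  change ∑ u, f u ^ 2 ≤ _
  obtain ⟨Q, hQ⟩ : ∃ Q : ℝ, Q = (Fintype.card α : ℝ) ^ L := ⟨_, rfl⟩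
  simp only [← hQ] at hvar hmean hq ⊢
  set m := (∑ u, f u) / Q with hm
  have hsum : ∑ u, f u = Q * m := by
    rw [hm]
    field_simp
  have hmle : m ^ 2 ≤ (4 * k * N) ^ 2 := by
    have : |m| ≤ 4 * k * N := by
      rw [hm, abs_div, abs_of_pos hq, div_le_iff₀ hq]
      linarith
    exact sq_le_sq' (abs_le.1 this).1 (abs_le.1 this).2
  have hexp : ∑ u, f u ^ 2 = ∑ u, (f u - m) ^ 2 + Q * m ^ 2 := by
    have h : ∀ u, f u ^ 2 = (f u - m) ^ 2 + 2 * m * f u - m ^ 2 := fun u => by ring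
    rw [sum_congr rfl fun u _ => h u, sum_sub_distrib, sum_add_distrib, ← mul_sum, hsum]
    simp only [sum_const, card_univ, nsmul_eq_mul, Fintype.card_fun, Fintype.card_fin,
      Nat.cast_pow, ← hQ]
    ring
  rw [hexp, mul_add]
  exact add_le_add hvar (mul_le_mul_of_nonneg_left hmle hq.le)

end Overwrite

section Computability

open Finset

theorem Primrec.sum_range {β : Type*} [Primcodable β] {N : β → ℕ} {g : β → ℕ → ℕ}
    (hN : Primrec N) (hg : Primrec₂ g) : Primrec fun a => ∑ p ∈ range (N a), g a p := by
  refine (Primrec.nat_rec' hN (Primrec.const 0)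
    (Primrec.nat_add.comp (Primrec.snd.comp Primrec.snd)
      (hg.comp Primrec.fst (Primrec.fst.comp Primrec.snd))).to₂).of_eq fun a => ?_
  induction N a with
  | zero => rfl
  | succ n ih =>
    rw [Finset.sum_range_succ, ← ih]

theorem Primrec.nat_pow_const {β : Type*} [Primcodable β] (b : ℕ) {g : β → ℕ} (hg : Primrec g) :
    Primrec fun a => b ^ g a := by
  refine (Primrec.nat_rec' hg (Primrec.const 1)
    (Primrec.nat_mul.comp (Primrec.snd.comp Primrec.snd) (Primrec.const b)).to₂).of_eq fun a => ?_
  induction g a with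
  | zero => rfl
  | succ n ih =>
    rw [pow_succ, ← ih]

variable {b : ℕ} [NeZero b]

/-- The number of words of length `k` with exactly `i` occurrences in `l` starting before `N`,
computed through the base-`b` codes of the blocks of `l`. -/
def listClassCard (k N i : ℕ) (l : List (Fin b)) : ℕ :=
  ∑ v ∈ range (b ^ k), if (∑ p ∈ range N,
    if (∑ t ∈ range k, (l.getD (p + t) default : ℕ) * b ^ t) = v then 1 else 0) = i then 1 else 0

theorem listClassCard_eq (k N i : ℕ) (l : List (Fin b)) :
    listClassCard k N i l = #(occClass (fun s => l.getD s default) k N i) := by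
  have hcode : ∀ p, ∑ t ∈ range k, (l.getD (p + t) default : ℕ) * b ^ t =
      (finFunctionFinEquiv (block (fun s => l.getD s default) k p) : ℕ) := by
    intro p
    rw [finFunctionFinEquiv_apply, ← Fin.sum_univ_eq_sum_range
      (fun t => (l.getD (p + t) default : ℕ) * b ^ t)]
    rfl
  unfold listClassCard
  simp only [hcode]
  rw [← Fin.sum_univ_eq_sum_range (fun v => if (∑ p ∈ range N,
    if (finFunctionFinEquiv (block (fun s => l.getD s default) k p) : ℕ) = v then 1 else 0) = i
      then 1 else 0), ← Equiv.sum_comp (finFunctionFinEquiv (m := b) (n := k)), sum_boole]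
  simp only [Fin.val_inj, EmbeddingLike.apply_eq_iff_eq, sum_boole]
  rfl

theorem primrec_listClassCard (i : ℕ) {N : ℕ → ℕ} (hN : Primrec N) :
    Primrec fun a : ℕ × List (Fin b) => listClassCard a.1 (N a.1) i a.2 := by
  have hdigit : Primrec₂ fun (a : ((ℕ × List (Fin b)) × ℕ) × ℕ) (t : ℕ) =>
      ((a.1.1.2.getD (a.2 + t) default : Fin b) : ℕ) * b ^ t := by
    refine (Primrec.nat_mul.comp (Primrec.fin_val.comp ((Primrec.list_getD default).comp
      (Primrec.snd.comp (Primrec.fst.comp (Primrec.fst.comp Primrec.fst)))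
      (Primrec.nat_add.comp (Primrec.snd.comp Primrec.fst) Primrec.snd)))
      (Primrec.nat_pow_const b Primrec.snd)).to₂
  have hcode := Primrec.sum_range (Primrec.fst.comp (Primrec.fst.comp Primrec.fst)) hdigit
  have hocc := Primrec.sum_range (β := (ℕ × List (Fin b)) × ℕ)
    (hN.comp (Primrec.fst.comp Primrec.fst))
    (Primrec.ite (Primrec.eq.comp hcode (Primrec.snd.comp Primrec.fst))
      (Primrec.const 1) (Primrec.const 0)).to₂
  exact Primrec.sum_range (Primrec.nat_pow_const b Primrec.fst)
    (Primrec.ite (Primrec.eq.comp hocc (Primrec.const i)) (Primrec.const 1) (Primrec.const 0)).to₂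

/-- The word `l` has normalised Stein defect larger than `1 / q`. -/
def LargeDefect (k N i q : ℕ) (l : List (Fin b)) : Prop :=
  b ^ k * b ^ k + q * (N * listClassCard k N i l) <
      q * ((i + 1) * listClassCard k N (i + 1) l * b ^ k) ∨
    b ^ k * b ^ k + q * ((i + 1) * listClassCard k N (i + 1) l * b ^ k) <
      q * (N * listClassCard k N i l)

instance (k N i q : ℕ) (l : List (Fin b)) : Decidable (LargeDefect k N i q l) := by
  unfold LargeDefect
  infer_instance

theorem primrecPred_largeDefect (i q : ℕ) {N : ℕ → ℕ} (hN : Primrec N) :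
    PrimrecPred fun a : ℕ × List (Fin b) => LargeDefect a.1 (N a.1) i q a.2 := by
  have hpow : Primrec fun a : ℕ × List (Fin b) => b ^ a.1 :=
    Primrec.nat_pow_const b Primrec.fst
  have hsq := Primrec.nat_mul.comp hpow hpow
  have h1 := Primrec.nat_mul.comp (Primrec.const q)
    (Primrec.nat_mul.comp (hN.comp Primrec.fst) (primrec_listClassCard (b := b) i hN))
  have h2 := Primrec.nat_mul.comp (Primrec.const q) (Primrec.nat_mul.comp (Primrec.nat_mul.comp
    (Primrec.const (i + 1)) (primrec_listClassCard (b := b) (i + 1) hN)) hpow)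
  exact (Primrec.nat_lt.comp (Primrec.nat_add.comp hsq h1) h2).or
    (Primrec.nat_lt.comp (Primrec.nat_add.comp hsq h2) h1)

theorem largeDefect_iff (k N i q : ℕ) (l : List (Fin b)) :
    LargeDefect k N i q l ↔
      ((b : ℝ) ^ k) ^ 2 < q * |steinDefect (fun s => l.getD s default) k N i| := by
  have hq : (0 : ℝ) ≤ q := Nat.cast_nonneg q
  unfold LargeDefect
  rw [← @Nat.cast_lt ℝ, ← @Nat.cast_lt ℝ, listClassCard_eq, listClassCard_eq,
    ← abs_of_nonneg hq, ← abs_mul, lt_abs]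
  unfold steinDefect
  push_cast
  rw [Fintype.card_fin]
  constructor
  · rintro (h | h)
    · left; linarith
    · right; linarith
  · rintro (h | h)
    · left; linarith
    · right; linarith

end Computability

section BorelCantelli

open Finset

variable {b : ℕ} {ν : Measure (ℕ → Fin b)}

theorem IsUnifProductMeasure.measure_cyl (hν : IsUnifProductMeasure b ν) (l : List (Fin b)) :
    ν (Cyl l) = ((b : ENNReal)⁻¹) ^ l.length :=
  hν l.length l.get

theorem mem_cyl_ofFn {L : ℕ} (x : ℕ → Fin b) : x ∈ Cyl (List.ofFn fun t : Fin L => x t) := by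
  intro i
  simp

theorem IsUnifProductMeasure.measure_iUnion_cyl_le (hν : IsUnifProductMeasure b ν) (hb : 0 < b)
    {L : ℕ} (S : Finset (Fin L → Fin b)) {c : ℝ} (hS : (#S : ℝ) ≤ (b : ℝ) ^ L * c) :
    ν (⋃ u ∈ S, Cyl (List.ofFn u)) ≤ ENNReal.ofReal c := by
  have hpos : (0 : ℝ) < (b : ℝ) ^ L := by positivity
  have hc : 0 ≤ c := by
    by_contra! h
    have := mul_neg_of_pos_of_neg hpos h
    have h0 : (0 : ℝ) ≤ #S := Nat.cast_nonneg _
    linarith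
  calc ν (⋃ u ∈ S, Cyl (List.ofFn u)) ≤ ∑ u ∈ S, ν (Cyl (List.ofFn u)) :=
        measure_biUnion_finset_le S _
    _ = (#S : ENNReal) * ((b : ENNReal)⁻¹) ^ L := by
        simp [hν.measure_cyl]
    _ ≤ (b : ENNReal) ^ L * ENNReal.ofReal c * ((b : ENNReal)⁻¹) ^ L := by
        gcongr
        have h := ENNReal.ofReal_le_ofReal hS
        rw [ENNReal.ofReal_mul hpos.le, ENNReal.ofReal_natCast, ENNReal.ofReal_pow (by positivity),
          ENNReal.ofReal_natCast] at h
        exact h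
    _ = ENNReal.ofReal c := by
        have hb0 : (b : ENNReal) ≠ 0 := by exact_mod_cast hb.ne'
        rw [mul_right_comm, ← mul_pow, ENNReal.mul_inv_cancel hb0 (ENNReal.natCast_ne_top b),
          one_pow, one_mul]

/-- Effective Borel–Cantelli lemma: a Martin-Löf random sequence eventually avoids a primitive
recursive sequence of clopen events whose probabilities decay geometrically. -/
theorem MLRandom.eventually_not_of_card_le (hb : 2 ≤ b) (hν : IsUnifProductMeasure b ν)
    {x : ℕ → Fin b} (hx : MLRandom b ν x) {len : ℕ → ℕ} (hlen : Primrec len)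
    {bad : ℕ → List (Fin b) → Prop} [∀ k l, Decidable (bad k l)]
    (hbad : PrimrecPred fun a : ℕ × List (Fin b) => bad a.1 a.2) {C : ℝ}
    (hcard : ∀ k, 0 < k → (#{u : Fin (len k) → Fin b | bad k (List.ofFn u)} : ℝ) ≤
      (b : ℝ) ^ len k * (C * (3 / 4) ^ k)) :
    ∀ᶠ k in atTop, ¬ bad k (List.ofFn fun t : Fin (len k) => x t) := by
  by_contra hfreq
  have hfreq' : ∃ᶠ k in atTop, bad k (List.ofFn fun t : Fin (len k) => x t) := by
    simpa [Filter.Frequently] using hfreq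
  have : NeZero b := ⟨by omega⟩
  obtain ⟨K, hK0, hK⟩ : ∃ K : ℕ, 0 < K ∧ C * (3 / 4) ^ K * 4 ≤ 1 / 2 := by
    have hlim : Tendsto (fun K : ℕ => C * (3 / 4 : ℝ) ^ K * 4) atTop (nhds (C * 0 * 4)) :=
      ((tendsto_pow_atTop_nhds_zero_of_lt_one (by norm_num) (by norm_num)).const_mul C).mul_const 4
    have hev := hlim.eventually (Iic_mem_nhds (show C * 0 * 4 < (1 / 2 : ℝ) by norm_num))
    obtain ⟨K, hK, hK0⟩ := (hev.and (eventually_gt_atTop 0)).exists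
    exact ⟨K, hK0, hK⟩
  let pad : ℕ → List (Fin b) := fun n => (List.range (n + 1)).map fun _ => default
  let good : ℕ → ℕ × List (Fin b) → Prop := fun n a =>
    a.2.length = len (3 * n + K + a.1) ∧ bad (3 * n + K + a.1) a.2
  let f : ℕ → ℕ → List (Fin b) := fun n e =>
    Option.casesOn (Encodable.decode (α := ℕ × List (Fin b)) e) (pad n)
      fun a => if good n a then a.2 else pad n
  have hpad : Primrec pad :=
    Primrec.list_map (Primrec.list_range.comp Primrec.succ) (Primrec.const default).to₂
  have hf : Computable₂ f := by
    have hk : Primrec fun c : (ℕ × ℕ) × (ℕ × List (Fin b)) => 3 * c.1.1 + K + c.2.1 :=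
      Primrec.nat_add.comp (Primrec.nat_add.comp (Primrec.nat_mul.comp (Primrec.const 3)
        (Primrec.fst.comp Primrec.fst)) (Primrec.const K)) (Primrec.fst.comp Primrec.snd)
    have hl : Primrec fun c : (ℕ × ℕ) × (ℕ × List (Fin b)) => c.2.2 :=
      Primrec.snd.comp Primrec.snd
    have hgood : PrimrecPred fun c : (ℕ × ℕ) × (ℕ × List (Fin b)) => good c.1.1 c.2 :=
      (Primrec.eq.comp (Primrec.list_length.comp hl) (hlen.comp hk)).and
        (hbad.comp (Primrec.pair hk hl))
    exact (Primrec.option_casesOn (Primrec.decode.comp Primrec.snd) (hpad.comp Primrec.fst)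
      (Primrec.ite hgood hl (hpad.comp (Primrec.fst.comp Primrec.fst))).to₂).to_comp
  refine hx (fun n => ⋃ e, Cyl (f n e)) ⟨⟨f, hf, fun n => rfl⟩, fun n => ?_⟩ ?_
  · let S : ∀ k, Finset (Fin (len k) → Fin b) := fun k => {u | bad k (List.ofFn u)}
    have hsub : (⋃ e, Cyl (f n e)) ⊆
        Cyl (pad n) ∪ ⋃ j : ℕ, ⋃ u ∈ S (3 * n + K + j), Cyl (List.ofFn u) := by
      refine Set.iUnion_subset fun e => ?_
      simp only [f]
      rcases Encodable.decode (α := ℕ × List (Fin b)) e with _ | ⟨j, l⟩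
      · exact Set.subset_union_left
      · by_cases hgood : good n (j, l)
        · simp only [if_pos hgood]
          obtain ⟨hl, hbl⟩ := hgood
          simp only at hl hbl
          refine Set.Subset.trans ?_ Set.subset_union_right
          refine Set.Subset.trans ?_ (Set.subset_iUnion _ j)
          have hofFn : List.ofFn (fun t : Fin (len (3 * n + K + j)) => l.get (t.cast hl.symm)) =
              l := by
            refine List.ext_getElem (by simp [hl]) fun m h1 h2 => ?_
            simp
          intro y hy
          refine Set.mem_biUnion (x := fun t => l.get (t.cast hl.symm)) ?_ ?_
          · simp only [S, mem_coe, mem_filter, mem_univ, true_and]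
            rwa [hofFn]
          · rwa [hofFn]
        · simp only [if_neg hgood]
          exact Set.subset_union_left
    have hpadν : ν (Cyl (pad n)) ≤ ((2 : ENNReal)⁻¹) ^ (n + 1) := by
      rw [hν.measure_cyl]
      simp only [pad, List.length_map, List.length_range]
      gcongr
      exact_mod_cast hb
    have hunion : ν (⋃ j : ℕ, ⋃ u ∈ S (3 * n + K + j), Cyl (List.ofFn u)) ≤
        ((2 : ENNReal)⁻¹) ^ (n + 1) := by
      have hC : 0 ≤ C := by
        have h1 := (Nat.cast_nonneg _).trans (hcard 1 one_pos)
        have h2 : (0 : ℝ) < (b : ℝ) ^ len 1 := by positivity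
        have h3 := (mul_nonneg_iff_of_pos_left h2).1 h1
        linarith
      have hsum : HasSum (fun j : ℕ => C * (3 / 4 : ℝ) ^ (3 * n + K + j))
          (C * (3 / 4) ^ (3 * n + K) * 4) := by
        have h := (hasSum_geometric_of_lt_one (r := (3 / 4 : ℝ)) (by norm_num)
          (by norm_num)).mul_left (C * (3 / 4) ^ (3 * n + K))
        have h4 : (1 - 3 / 4 : ℝ)⁻¹ = 4 := by norm_num
        simpa only [mul_assoc, ← pow_add, h4] using h
      calc ν (⋃ j : ℕ, ⋃ u ∈ S (3 * n + K + j), Cyl (List.ofFn u))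
          ≤ ∑' j : ℕ, ν (⋃ u ∈ S (3 * n + K + j), Cyl (List.ofFn u)) := measure_iUnion_le _
        _ ≤ ∑' j : ℕ, ENNReal.ofReal (C * (3 / 4) ^ (3 * n + K + j)) :=
            ENNReal.tsum_le_tsum fun j =>
              hν.measure_iUnion_cyl_le (by omega) _ (hcard _ (by omega))
        _ = ENNReal.ofReal (C * (3 / 4) ^ (3 * n + K) * 4) := by
            rw [← ENNReal.ofReal_tsum_of_nonneg (fun j => by positivity) hsum.summable,
              hsum.tsum_eq]
        _ ≤ ENNReal.ofReal ((2⁻¹) ^ (n + 1)) := by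
            refine ENNReal.ofReal_le_ofReal ?_
            calc C * (3 / 4) ^ (3 * n + K) * 4 = (27 / 64 : ℝ) ^ n * (C * (3 / 4) ^ K * 4) := by
                  rw [pow_add, pow_mul]
                  norm_num
                  ring
              _ ≤ (2⁻¹ : ℝ) ^ n * (1 / 2) := by
                  gcongr
                  norm_num
              _ = (2⁻¹ : ℝ) ^ (n + 1) := by rw [pow_succ]; norm_num
        _ = ((2 : ENNReal)⁻¹) ^ (n + 1) := by
            rw [ENNReal.ofReal_pow (by norm_num), ENNReal.ofReal_inv_of_pos (by norm_num)]
            norm_num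
    calc ν (⋃ e, Cyl (f n e))
        ≤ ν (Cyl (pad n)) + ν (⋃ j : ℕ, ⋃ u ∈ S (3 * n + K + j), Cyl (List.ofFn u)) :=
          (measure_mono hsub).trans (measure_union_le _ _)
      _ ≤ ((2 : ENNReal)⁻¹) ^ (n + 1) + ((2 : ENNReal)⁻¹) ^ (n + 1) := add_le_add hpadν hunion
      _ = ((2 : ENNReal)⁻¹) ^ n := by
          rw [← mul_two, pow_succ, mul_assoc, ENNReal.inv_mul_cancel (by norm_num) (by norm_num),
            mul_one]
  · refine Set.mem_iInter.2 fun n => ?_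
    obtain ⟨k, hk, hbk⟩ := frequently_atTop.1 hfreq' (3 * n + K)
    obtain ⟨j, rfl⟩ := Nat.exists_eq_add_of_le hk
    refine Set.mem_iUnion.2
      ⟨Encodable.encode (j, List.ofFn fun t : Fin (len (3 * n + K + j)) => x t), ?_⟩
    have hgood : good n (j, List.ofFn fun t : Fin (len (3 * n + K + j)) => x t) :=
      ⟨by simp, hbk⟩
    simp only [f, Encodable.encodek, if_pos hgood]
    exact mem_cyl_ofFn x

end BorelCantelli

section PoissonLimit

open Finset

/-- Weights that asymptotically satisfy the Poisson recursion and are uniformly tight converge to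
the Poisson weights. -/
theorem tendsto_poisson_of_recursion {a : ℕ → ℕ → ℝ} {lam : ℝ} (h0 : ∀ k i, 0 ≤ a k i)
    (hrec : ∀ i : ℕ, Tendsto (fun k => ((i : ℝ) + 1) * a k (i + 1) - lam * a k i) atTop (nhds 0))
    (hle : ∀ k m, ∑ i ∈ range m, a k i ≤ 1)
    (hge : ∀ k m : ℕ, 0 < m → 1 - lam / m ≤ ∑ i ∈ range m, a k i) (i : ℕ) :
    Tendsto (fun k => a k i) atTop (nhds (Real.exp (-lam) * lam ^ i / (Nat.factorial i : ℝ))) := by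
  have hratio : ∀ i : ℕ, Tendsto (fun k => a k i - lam ^ i / (Nat.factorial i : ℝ) * a k 0) atTop
      (nhds 0) := by
    intro i
    induction i with
    | zero => simp
    | succ i ih =>
      have h := ((hrec i).add (ih.const_mul lam)).div_const ((i : ℝ) + 1)
      simp only [mul_zero, add_zero, zero_div] at h
      refine h.congr fun k => ?_
      have hi : (i : ℝ) + 1 ≠ 0 := by positivity
      have hf : (Nat.factorial i : ℝ) ≠ 0 := by positivity
      rw [Nat.factorial_succ]
      push_cast
      field_simp
      ring
  have ha0_le : ∀ k, a k 0 ≤ 1 := fun k => by simpa using hle k 1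
  have hsum : ∀ m : ℕ, Tendsto (fun k => ∑ i ∈ range m, a k i -
      (∑ i ∈ range m, lam ^ i / (Nat.factorial i : ℝ)) * a k 0) atTop (nhds 0) := by
    intro m
    have h := tendsto_finsetSum (range m) fun i _ => hratio i
    simp only [sum_const_zero] at h
    refine h.congr fun k => ?_
    rw [sum_sub_distrib, sum_mul]
  have hexp : Tendsto (fun m : ℕ => ∑ i ∈ range m, lam ^ i / (Nat.factorial i : ℝ)) atTop
      (nhds (Real.exp lam)) := by
    rw [Real.exp_eq_exp_ℝ]
    exact (NormedSpace.expSeries_div_hasSum_exp lam).tendsto_sum_nat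
  have hinv : Tendsto (fun m : ℕ => lam / (m : ℝ)) atTop (nhds 0) :=
    tendsto_const_div_atTop_nhds_zero_nat lam
  have hnorm : Tendsto (fun k => Real.exp lam * a k 0) atTop (nhds 1) := by
    rw [Metric.tendsto_atTop]
    intro ε hε
    obtain ⟨m, ⟨hm1, hm2⟩, hm⟩ := (((Metric.tendsto_nhds.1 hexp (ε / 4) (by positivity)).and
      (Metric.tendsto_nhds.1 hinv (ε / 4) (by positivity))).and (eventually_gt_atTop 0)).exists
    obtain ⟨k₀, hk₀⟩ := Metric.tendsto_atTop.1 (hsum m) (ε / 4) (by positivity)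
    refine ⟨k₀, fun k hk => ?_⟩
    have h1 := hk₀ k hk
    rw [Real.dist_eq] at hm1 hm2 h1 ⊢
    rw [sub_zero] at hm2 h1
    have h2 : |(∑ i ∈ range m, lam ^ i / (Nat.factorial i : ℝ) - Real.exp lam) * a k 0| ≤
        ε / 4 := by
      rw [abs_mul, abs_of_nonneg (h0 k 0)]
      calc _ ≤ |∑ i ∈ range m, lam ^ i / (Nat.factorial i : ℝ) - Real.exp lam| * 1 :=
            mul_le_mul_of_nonneg_left (ha0_le k) (abs_nonneg _)
        _ ≤ ε / 4 := by linarith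
    have h3 := hle k m
    have h4 := hge k m hm
    rw [abs_lt] at h1 hm2 ⊢
    rw [abs_le] at h2
    constructor <;> linarith [h1.1, h1.2, h2.1, h2.2, hm2.1, hm2.2]
  have hzero : Tendsto (fun k => a k 0) atTop (nhds (Real.exp (-lam))) := by
    have h := hnorm.const_mul (Real.exp (-lam))
    rw [mul_one] at h
    refine h.congr fun k => ?_
    rw [← mul_assoc, ← Real.exp_add, neg_add_cancel, Real.exp_zero, one_mul]
  have h := (hratio i).add (hzero.const_mul (lam ^ i / (Nat.factorial i : ℝ)))
  refine (h.congr fun k => by ring).trans_eq ?_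
  congr 1
  ring

variable {α : Type*} [Fintype α] [DecidableEq α]

theorem sum_card_occClass (y : ℕ → α) (k N m : ℕ) :
    ∑ i ∈ range m, #(occClass y k N i) = #{w : Fin k → α | occCount y k N w < m} := by
  rw [card_eq_sum_card_fiberwise (f := occCount y k N) (t := range m) fun w hw => by
    simpa using hw]
  refine sum_congr rfl fun i hi => ?_
  unfold occClass
  rw [filter_filter]
  congr 1
  refine filter_congr fun w _ => ⟨fun h => ⟨h ▸ mem_range.1 hi, h⟩, fun h => h.2⟩

theorem sum_card_occClass_le (y : ℕ → α) (k N m : ℕ) :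
    ∑ i ∈ range m, #(occClass y k N i) ≤ Fintype.card α ^ k := by
  rw [sum_card_occClass]
  exact (card_le_univ _).trans_eq (by simp)

theorem mul_card_pow_le (y : ℕ → α) (k N m : ℕ) :
    m * Fintype.card α ^ k ≤ m * ∑ i ∈ range m, #(occClass y k N i) + N := by
  have hsplit := card_filter_add_card_filter_not (s := (univ : Finset (Fin k → α)))
    fun w => occCount y k N w < m
  have hmarkov : #{w : Fin k → α | ¬ occCount y k N w < m} * m ≤ N := by
    calc #{w : Fin k → α | ¬ occCount y k N w < m} * m
        ≤ ∑ w : Fin k → α with ¬ occCount y k N w < m, occCount y k N w :=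
          card_nsmul_le_sum _ _ _ fun w hw => by simpa using hw
      _ ≤ ∑ w : Fin k → α, occCount y k N w := sum_le_sum_of_subset (filter_subset _ _)
      _ = N := sum_occCount y k N
  rw [sum_card_occClass]
  simp only [card_univ, Fintype.card_fun, Fintype.card_fin] at hsplit
  rw [← hsplit]
  linarith

theorem card_occClass_le_of_occCount_eq {y : ℕ → α} {k N N' i : ℕ} {T : Finset (Fin k → α)}
    (h : ∀ w ∉ T, occCount y k N w = occCount y k N' w) :
    #(occClass y k N i) ≤ #(occClass y k N' i) + #T := by
  refine (card_le_card (t := occClass y k N' i ∪ T) fun w hw => ?_).trans (card_union_le _ _)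
  by_cases hwT : w ∈ T
  · exact mem_union_right _ hwT
  · refine mem_union_left _ ?_
    simp only [occClass, mem_filter, mem_univ, true_and] at hw ⊢
    rw [← h w hwT, hw]

theorem abs_card_occClass_sub_le_of_le (y : ℕ → α) (k i : ℕ) {N N' : ℕ} (hN : N ≤ N') :
    |(#(occClass y k N' i) : ℝ) - #(occClass y k N i)| ≤ (N' : ℝ) - N := by
  set T := (Finset.Ico N N').image (block y k) with hT
  have hTcard : #T ≤ N' - N := card_image_le.trans_eq (by simp)
  have hocc : ∀ w ∉ T, occCount y k N w = occCount y k N' w := by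
    intro w hw
    unfold occCount
    congr 1
    ext p
    simp only [mem_filter, mem_range]
    refine ⟨fun h => ⟨by omega, h.2⟩, fun h => ⟨?_, h.2⟩⟩
    by_contra hp
    exact hw (mem_image.2 ⟨p, Finset.mem_Ico.2 (by omega), h.2⟩)
  have h1 := card_occClass_le_of_occCount_eq (i := i) hocc
  have h2 := card_occClass_le_of_occCount_eq (i := i) fun w hw => (hocc w hw).symm
  rw [abs_le, ← Nat.cast_sub hN]
  have h3 : (#(occClass y k N i) : ℝ) ≤ #(occClass y k N' i) + (N' - N : ℕ) := by
    exact_mod_cast h1.trans (by omega)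
  have h4 : (#(occClass y k N' i) : ℝ) ≤ #(occClass y k N i) + (N' - N : ℕ) := by
    exact_mod_cast h2.trans (by omega)
  constructor <;> linarith

theorem abs_card_occClass_sub_le_abs (y : ℕ → α) (k i N N' : ℕ) :
    |(#(occClass y k N' i) : ℝ) - #(occClass y k N i)| ≤ |(N' : ℝ) - N| := by
  rcases le_total N N' with h | h
  · exact (abs_card_occClass_sub_le_of_le y k i h).trans (le_abs_self _)
  · rw [abs_sub_comm, abs_sub_comm (N' : ℝ)]
    exact (abs_card_occClass_sub_le_of_le y k i h).trans (le_abs_self _)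

end PoissonLimit

section MartinLof

open Finset

variable {b : ℕ}

theorem Z_eq_card_occClass_div (k i : ℕ) (lam : ℝ) (x : ℕ → Fin b) :
    Z b k i lam x = #(occClass x k ⌊lam * (b : ℝ) ^ k⌋₊ i) / (b : ℝ) ^ k := by
  have hocc : ∀ (N : ℕ) (w : Fin k → Fin b),
      #{j ∈ Finset.Icc 1 N | OccursAt x j w} = occCount x k N w := by
    intro N w
    unfold occCount
    refine card_nbij' (fun j => j - 1) (fun p => p + 1) ?_ ?_ ?_ ?_
    · intro j hj
      simp only [coe_filter, Finset.mem_Icc, Set.mem_ofPred_eq, mem_range] at hj ⊢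
      exact ⟨by omega, funext hj.2⟩
    · intro p hp
      simp only [coe_filter, Finset.mem_Icc, Set.mem_ofPred_eq, mem_range] at hp ⊢
      exact ⟨by omega, fun t => congrFun hp.2 t⟩
    · intro j hj
      simp only [coe_filter, Finset.mem_Icc, Set.mem_ofPred_eq] at hj
      simp only
      omega
    · intro p _
      simp
  unfold Z occClass
  simp only [hocc]

/-- The probability that the normalised Stein defect exceeds `1 / q` decays geometrically. -/
theorem exists_card_largeDefect_le [NeZero b] (hb : 2 ≤ b) (i q Λ : ℕ) {N : ℕ → ℕ}
    (hN : ∀ k, N k ≤ Λ * b ^ k) :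
    ∃ C : ℝ, ∀ k, 0 < k →
      (#{u : Fin (N k + k) → Fin b | LargeDefect k (N k) i q (List.ofFn u)} : ℝ) ≤
        (b : ℝ) ^ (N k + k) * (C * (3 / 4) ^ k) := by
  obtain ⟨D, hD⟩ : ∃ D : ℝ, ∀ k : ℕ, (k : ℝ) ^ 2 * (2 / 3) ^ k ≤ D := by
    have h := (tendsto_pow_const_mul_const_pow_of_abs_lt_one 2 (r := (2 / 3 : ℝ))
      (by rw [abs_lt]; norm_num)).bddAbove_range
    obtain ⟨D, hD⟩ := h
    exact ⟨D, fun k => hD ⟨k, rfl⟩⟩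
  set A : ℝ := (Λ + 1) * (2 * (i + 1 + Λ)) ^ 2 + (4 * Λ) ^ 2 with hA
  have hA0 : 0 ≤ A := by positivity
  refine ⟨q ^ 2 * A * D, fun k hk => ?_⟩
  set S : Finset (Fin (N k + k) → Fin b) :=
    {u | LargeDefect k (N k) i q (List.ofFn u)} with hS
  set B : ℝ := (b : ℝ) ^ k with hB
  have hb2 : (2 : ℝ) ≤ b := by exact_mod_cast hb
  have hB2 : (2 : ℝ) ^ k ≤ B := pow_le_pow_left₀ (by norm_num) hb2 k
  have hB1 : 1 ≤ B := (one_le_pow₀ (by norm_num : (1 : ℝ) ≤ 2)).trans hB2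
  have hkB : (k : ℝ) ≤ B :=
    le_trans (by exact_mod_cast Nat.lt_two_pow_self.le) hB2
  have hNB : (N k : ℝ) ≤ Λ * B := by
    rw [hB]
    exact_mod_cast hN k
  have hmoment : ∑ u : Fin (N k + k) → Fin b, steinDefect (extendWord u) k (N k) i ^ 2 ≤
      (b : ℝ) ^ (N k + k) * (A * (k ^ 2 * B ^ 3)) := by
    refine (sum_sq_steinDefect_le i le_rfl hk).trans ?_
    rw [Fintype.card_fin, ← hB]
    refine mul_le_mul_of_nonneg_left ?_ (by positivity)
    have h1 : ((N k + k : ℕ) : ℝ) ≤ (Λ + 1) * B := by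
      push_cast
      linarith
    have h2 : (i + 1) * B + N k ≤ (i + 1 + Λ) * B := by linarith
    calc ((N k + k : ℕ) : ℝ) * (2 * k * ((i + 1) * B + N k)) ^ 2 + (4 * k * N k) ^ 2
        ≤ ((Λ + 1) * B) * (2 * k * ((i + 1 + Λ) * B)) ^ 2 + (4 * k * (Λ * B)) ^ 2 := by gcongr
      _ = (Λ + 1) * (2 * (i + 1 + Λ)) ^ 2 * (k ^ 2 * B ^ 3) +
          (4 * Λ) ^ 2 * (k ^ 2 * B ^ 2) := by ring
      _ ≤ (Λ + 1) * (2 * (i + 1 + Λ)) ^ 2 * (k ^ 2 * B ^ 3) +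
          (4 * Λ) ^ 2 * (k ^ 2 * B ^ 3) := by
          gcongr
          norm_num
      _ = A * (k ^ 2 * B ^ 3) := by rw [hA]; ring
  have hlarge : ∀ u ∈ S, B ^ 4 ≤ q ^ 2 * steinDefect (extendWord u) k (N k) i ^ 2 := by
    intro u hu
    have h := (largeDefect_iff k (N k) i q (List.ofFn u)).1 (mem_filter.1 hu).2
    rw [steinDefect_congr (z := extendWord u) (fun s hs => by simp [extendWord, hs])] at h
    calc B ^ 4 = (B ^ 2) ^ 2 := by ring
      _ ≤ (q * |steinDefect (extendWord u) k (N k) i|) ^ 2 :=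
          pow_le_pow_left₀ (by positivity) h.le 2
      _ = _ := by rw [mul_pow, sq_abs]
  have hchebyshev : (#S : ℝ) * B ^ 4 ≤
      q ^ 2 * ((b : ℝ) ^ (N k + k) * (A * (k ^ 2 * B ^ 3))) := by
    calc (#S : ℝ) * B ^ 4 = ∑ _u ∈ S, B ^ 4 := by rw [sum_const, nsmul_eq_mul]
      _ ≤ ∑ u ∈ S, q ^ 2 * steinDefect (extendWord u) k (N k) i ^ 2 := sum_le_sum hlarge
      _ ≤ ∑ u, q ^ 2 * steinDefect (extendWord u) k (N k) i ^ 2 :=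
          sum_le_sum_of_subset_of_nonneg (subset_univ _) fun u _ _ => by positivity
      _ = q ^ 2 * ∑ u, steinDefect (extendWord u) k (N k) i ^ 2 := by rw [mul_sum]
      _ ≤ _ := mul_le_mul_of_nonneg_left hmoment (by positivity)
  have hdecay : (k : ℝ) ^ 2 ≤ D * (3 / 4) ^ k * B := by
    have h1 : (k : ℝ) ^ 2 = k ^ 2 * (2 / 3) ^ k * ((3 / 4) ^ k * 2 ^ k) := by
      rw [mul_assoc, ← mul_pow, ← mul_pow]
      norm_num
    have hD0 : 0 ≤ D := by simpa using (hD 0)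
    rw [h1, mul_assoc D]
    have := hD k
    gcongr
  refine le_of_mul_le_mul_right (hchebyshev.trans ?_) (show 0 < B ^ 4 by positivity)
  calc (q : ℝ) ^ 2 * ((b : ℝ) ^ (N k + k) * (A * (k ^ 2 * B ^ 3)))
      ≤ (q : ℝ) ^ 2 * ((b : ℝ) ^ (N k + k) * (A * ((D * (3 / 4) ^ k * B) * B ^ 3))) := by
        gcongr
    _ = (b : ℝ) ^ (N k + k) * (q ^ 2 * A * D * (3 / 4) ^ k) * B ^ 4 := by ring

theorem MLRandom.tendsto_steinDefect {ν : Measure (ℕ → Fin b)} (hb : 2 ≤ b)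
    (hν : IsUnifProductMeasure b ν) {x : ℕ → Fin b} (hx : MLRandom b ν x) (i Λ : ℕ) {N : ℕ → ℕ}
    (hNprim : Primrec N) (hN : ∀ k, N k ≤ Λ * b ^ k) :
    Tendsto (fun k => steinDefect x k (N k) i / ((b : ℝ) ^ k) ^ 2) atTop (nhds 0) := by
  have : NeZero b := ⟨by omega⟩
  rw [Metric.tendsto_nhds]
  intro ε hε
  obtain ⟨q, hq⟩ := exists_nat_gt (1 / ε)
  have hq0 : (0 : ℝ) < q := (by positivity : (0 : ℝ) < 1 / ε).trans hq
  obtain ⟨C, hC⟩ := exists_card_largeDefect_le hb i q Λ hN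
  have hlen : Primrec fun k => N k + k := Primrec.nat_add.comp hNprim Primrec.id
  filter_upwards [hx.eventually_not_of_card_le hb hν hlen
    (primrecPred_largeDefect (b := b) i q hNprim) hC] with k hk
  rw [largeDefect_iff, not_lt,
    steinDefect_congr (z := x) (fun s hs => by simp [hs])] at hk
  have hB : (0 : ℝ) < ((b : ℝ) ^ k) ^ 2 := by positivity
  rw [Real.dist_eq, sub_zero, abs_div, abs_of_pos hB, div_lt_iff₀ hB]
  rw [div_lt_iff₀ hε] at hq
  refine lt_of_mul_lt_mul_left ?_ hq0.le
  nlinarith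

theorem MLRandom.lamPoissonGeneric_of_rat {ν : Measure (ℕ → Fin b)} (hb : 2 ≤ b)
    (hν : IsUnifProductMeasure b ν) {x : ℕ → Fin b} (hx : MLRandom b ν x) (c d : ℕ) (hd : 0 < d) :
    LamPoissonGeneric b ((c : ℝ) / d) x := by
  set lam : ℝ := (c : ℝ) / d with hlam
  have hlam0 : 0 ≤ lam := by positivity
  have hBpos : ∀ k : ℕ, (0 : ℝ) < (b : ℝ) ^ k := fun k => by positivity
  set N : ℕ → ℕ := fun k => ⌊lam * (b : ℝ) ^ k⌋₊ with hN_def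
  have hN_eq : ∀ k, N k = c * b ^ k / d := by
    intro k
    rw [hN_def, ← Nat.floor_div_eq_div (K := ℝ)]
    simp only [hlam]
    congr 1
    push_cast
    ring
  have hNprim : Primrec N := by
    refine (Primrec.nat_div.comp (Primrec.nat_mul.comp (Primrec.const c)
      (Primrec.nat_pow_const b Primrec.id)) (Primrec.const d)).of_eq fun k => ?_
    rw [hN_eq]
    rfl
  have hNle : ∀ k, N k ≤ c * b ^ k := fun k => by
    rw [hN_eq]
    exact Nat.div_le_self _ _
  have hNlam : ∀ k, (N k : ℝ) ≤ lam * (b : ℝ) ^ k := fun k =>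
    Nat.floor_le (mul_nonneg hlam0 (hBpos k).le)
  have hNlim : Tendsto (fun k => (N k : ℝ) / (b : ℝ) ^ k) atTop (nhds lam) := by
    have hb1 : (1 : ℝ) < b := by exact_mod_cast hb
    exact (tendsto_nat_floor_mul_div_atTop hlam0).comp (tendsto_pow_atTop_atTop_of_one_lt hb1)
  have hZ : ∀ k i, Z b k i lam x = #(occClass x k (N k) i) / (b : ℝ) ^ k := fun k i =>
    Z_eq_card_occClass_div k i lam x
  have hsum : ∀ k m, ∑ i ∈ range m, Z b k i lam x =
      (∑ i ∈ range m, #(occClass x k (N k) i) : ℕ) / (b : ℝ) ^ k := by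
    intro k m
    simp only [hZ]
    rw [← sum_div]
    push_cast
    rfl
  have hZle : ∀ k m, ∑ i ∈ range m, Z b k i lam x ≤ 1 := by
    intro k m
    rw [hsum, div_le_one (hBpos k)]
    have := sum_card_occClass_le x k (N k) m
    rw [Fintype.card_fin] at this
    exact_mod_cast this
  have hZ0 : ∀ k i, 0 ≤ Z b k i lam x := fun k i => by
    rw [hZ]
    positivity
  refine tendsto_poisson_of_recursion (lam := lam) hZ0 (fun i => ?_) hZle fun k m hm => ?_
  · have h1 := hx.tendsto_steinDefect hb hν i c hNprim hNle
    have h2 : Tendsto (fun k => ((N k : ℝ) / (b : ℝ) ^ k - lam) * Z b k i lam x) atTop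
        (nhds 0) := by
      have hNsub : Tendsto (fun k => |(N k : ℝ) / (b : ℝ) ^ k - lam|) atTop (nhds 0) := by
        simpa using (hNlim.sub_const lam).abs
      refine squeeze_zero_norm (fun k => ?_) hNsub
      have hZ1 : Z b k i lam x ≤ 1 :=
        (single_le_sum (fun j _ => hZ0 k j) (self_mem_range_succ i)).trans (hZle k (i + 1))
      rw [norm_mul, Real.norm_eq_abs, Real.norm_of_nonneg (hZ0 k i)]
      exact mul_le_of_le_one_right (abs_nonneg _) hZ1
    have h := h1.add h2
    rw [add_zero] at h
    refine h.congr fun k => ?_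
    have hB := (hBpos k).ne'
    rw [hZ, hZ]
    unfold steinDefect
    rw [Fintype.card_fin]
    field_simp
    ring
  · rw [hsum]
    have hm' : (0 : ℝ) < m := by exact_mod_cast hm
    have h := mul_card_pow_le x k (N k) m
    rw [Fintype.card_fin] at h
    have h' : (m : ℝ) * (b : ℝ) ^ k ≤
        m * (∑ i ∈ range m, #(occClass x k (N k) i) : ℕ) + N k := by exact_mod_cast h
    rw [le_div_iff₀ (hBpos k), sub_mul, one_mul, div_mul_eq_mul_div, sub_le_iff_le_add,
      ← mul_le_mul_iff_right₀ hm', mul_add, mul_div_cancel₀ _ hm'.ne']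
    linarith [hNlam k]

end MartinLof

theorem stmt17 (b : ℕ) (hb : 2 ≤ b) (ν : Measure (ℕ → Fin b))
    (hν : IsUnifProductMeasure b ν) (x : ℕ → Fin b) (hx : MLRandom b ν x) :
    PoissonGeneric b x := by
  intro lam hlam i
  set P : ℝ → ℝ := fun r => Real.exp (-r) * r ^ i / (Nat.factorial i : ℝ)
  have hPcont : Continuous P := by fun_prop
  have hb1 : (1 : ℝ) < b := by exact_mod_cast hb
  have hfloor : ∀ r : ℝ, 0 ≤ r →
      Tendsto (fun k : ℕ => (⌊r * (b : ℝ) ^ k⌋₊ : ℝ) / (b : ℝ) ^ k) atTop (nhds r) := fun r hr =>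
    (tendsto_nat_floor_mul_div_atTop hr).comp (tendsto_pow_atTop_atTop_of_one_lt hb1)
  rw [Metric.tendsto_nhds]
  intro ε hε
  obtain ⟨δ, hδ, hPδ⟩ := Metric.continuous_iff.1 hPcont lam (ε / 4) (by positivity)
  obtain ⟨r, hr1, hr2⟩ := exists_rat_btwn (show lam < lam + min δ (ε / 4) by
    have : 0 < min δ (ε / 4) := by positivity
    linarith)
  have hr0 : (0 : ℝ) < r := hlam.trans hr1
  have hr : (r : ℝ) = (r.num.toNat : ℝ) / (r.den : ℝ) := by
    have hnum : (0 : ℤ) ≤ r.num := Rat.num_nonneg.2 (by exact_mod_cast hr0.le)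
    rw [Rat.cast_def]
    congr 1
    exact_mod_cast (Int.toNat_of_nonneg hnum).symm
  have hgen : LamPoissonGeneric b (r : ℝ) x := by
    rw [hr]
    exact hx.lamPoissonGeneric_of_rat hb hν _ _ r.den_pos
  have hdist : dist (r : ℝ) lam < min δ (ε / 4) := by
    rw [Real.dist_eq, abs_lt]
    constructor <;> linarith
  have hdiff : Tendsto (fun k : ℕ => |(⌊lam * (b : ℝ) ^ k⌋₊ : ℝ) / (b : ℝ) ^ k -
      (⌊(r : ℝ) * (b : ℝ) ^ k⌋₊ : ℝ) / (b : ℝ) ^ k|) atTop (nhds |lam - r|) :=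
    ((hfloor lam hlam.le).sub (hfloor r hr0.le)).abs
  have hdiff_lt : |lam - r| < ε / 4 := by
    rw [abs_sub_comm, ← Real.dist_eq]
    exact hdist.trans_le (min_le_right _ _)
  filter_upwards [Metric.tendsto_nhds.1 (hgen i) (ε / 4) (by positivity),
    hdiff.eventually (gt_mem_nhds hdiff_lt)] with k h1 h2
  have h3 : |Z b k i lam x - Z b k i r x| < ε / 4 := by
    refine lt_of_le_of_lt ?_ h2
    rw [Z_eq_card_occClass_div, Z_eq_card_occClass_div, ← sub_div, ← sub_div, abs_div, abs_div]
    exact div_le_div_of_nonneg_right (abs_card_occClass_sub_le_abs x k i _ _) (abs_nonneg _)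
  have h4 := hPδ r (hdist.trans_le (min_le_left _ _))
  calc dist (Z b k i lam x) (P lam)
      ≤ dist (Z b k i lam x) (Z b k i r x) + dist (Z b k i r x) (P r) + dist (P r) (P lam) :=
        dist_triangle4 _ _ _ _
    _ < ε / 4 + ε / 4 + ε / 4 := by
        rw [Real.dist_eq (Z b k i lam x)]
        gcongr
    _ < ε := by linarith
end

section
/- Let (U_n)_{n≥1} be a constructive Borel–Cantelli sequence of open subsets of the Cantor space Ω^ℕ (with product measure μ^ℕ). Then the Borel–Cantelli set ∪_{k≥1} ∩_{n>k} U_n contains, inside every nonempty basic open cylinder B_w, a computable element; in particular it contains a sequence of uniformly computable elements that is dense in Ω^ℕ. -/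
open MeasureTheory Filter

/-- A uniformly computable sequence of open subsets of Ω^ℕ: each U n is the union of a
computably enumerated sequence of basic cylinders. -/
def UnifComputableOpens (b : ℕ) (U : ℕ → Set (ℕ → Fin b)) : Prop :=
  ∃ f : ℕ → ℕ → List (Fin b), Computable₂ f ∧ ∀ n, U n = ⋃ i : ℕ, Cyl (f n i)

/-- (U_n) is a constructive Borel–Cantelli sequence for ν: it is uniformly computable and
the sequence (ν(Ω^ℕ ∖ U_n)) is effectively summable. -/
def ConstructiveBC (b : ℕ) (ν : Measure (ℕ → Fin b)) (U : ℕ → Set (ℕ → Fin b)) : Prop :=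
  UnifComputableOpens b U ∧
  ∃ g : ℚ → ℕ, Computable g ∧
    ∀ ε : ℚ, 0 < ε → (∑' i : ℕ, ν ((U (g ε + i))ᶜ)) < ENNReal.ofReal (ε : ℝ)

/-- The Borel–Cantelli set ∪_{k≥1} ∩_{n>k} U_n of a sequence of sets. -/
def BCset {b : ℕ} (U : ℕ → Set (ℕ → Fin b)) : Set (ℕ → Fin b) :=
  {x | ∃ k : ℕ, ∀ n : ℕ, k < n → x ∈ U n}

open Encodable

namespace ComputablePred

variable {α β : Type*} [Primcodable α] [Primcodable β]

theorem comp_computable {p : β → Prop} {f : α → β} (hp : ComputablePred p) (hf : Computable f) :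
    ComputablePred fun a => p (f a) := by
  classical exact (hp.decide.comp hf).computablePred

protected theorem and {p q : α → Prop} (hp : ComputablePred p) (hq : ComputablePred q) :
    ComputablePred fun a => p a ∧ q a := by
  classical
  exact ((Primrec.and.to_comp.comp hp.decide hq.decide).of_eq fun a => by simp).computablePred

protected theorem imp {p q : α → Prop} (hp : ComputablePred p) (hq : ComputablePred q) :
    ComputablePred fun a => p a → q a :=
  (hp.and hq.not).not.of_eq fun a => by tauto

protected theorem eq {f g : α → β} (hf : Computable f) (hg : Computable g) :
    ComputablePred fun a => f a = g a :=
  (show ComputablePred fun x : β × β => x.1 = x.2 from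
    PrimrecPred.computablePred Primrec.eq).comp_computable (hf.pair hg)

theorem le {f g : α → ℕ} (hf : Computable f) (hg : Computable g) :
    ComputablePred fun a => f a ≤ g a :=
  (show ComputablePred fun x : ℕ × ℕ => x.1 ≤ x.2 from
    PrimrecPred.computablePred Primrec.nat_le).comp_computable (hf.pair hg)

theorem lt {f g : α → ℕ} (hf : Computable f) (hg : Computable g) :
    ComputablePred fun a => f a < g a :=
  (le hg hf).not.of_eq fun _ => not_le

/-- Counting the solutions of a computable predicate below a computable bound is computable. -/
theorem count {p : α → ℕ → Prop} [∀ a, DecidablePred (p a)] {h : α → ℕ}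
    (hp : ComputablePred fun x : α × ℕ => p x.1 x.2) (hh : Computable h) :
    Computable fun a => Nat.count (p a) (h a) := by
  have hstep : Computable₂ fun (a : α) (x : ℕ × ℕ) =>
      cond (decide (p a x.1)) (x.2 + 1) x.2 :=
    Computable.cond
      (hp.decide.comp (Computable.fst.pair (Computable.fst.comp Computable.snd)))
      (Computable.succ.comp (Computable.snd.comp Computable.snd))
      (Computable.snd.comp Computable.snd)
  refine (Computable.nat_rec hh (Computable.const 0) hstep).of_eq fun a => ?_
  induction h a with
  | zero => simp
  | succ n ih =>
    rw [Nat.count_succ, ← ih]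
    by_cases hn : p a n <;> simp [hn]

theorem forall_lt {p : α → ℕ → Prop} {h : α → ℕ}
    (hp : ComputablePred fun x : α × ℕ => p x.1 x.2) (hh : Computable h) :
    ComputablePred fun a => ∀ n < h a, p a n := by
  classical
  exact (ComputablePred.eq (hp.count hh) hh).of_eq fun a => Nat.count_iff_forall

theorem exists_lt {p : α → ℕ → Prop} {h : α → ℕ}
    (hp : ComputablePred fun x : α × ℕ => p x.1 x.2) (hh : Computable h) :
    ComputablePred fun a => ∃ n < h a, p a n :=
  (forall_lt (p := fun a n => ¬ p a n) hp.not hh).not.of_eq fun a => by push Not; rfl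

theorem isPrefix {f g : α → List β} (hf : Computable f) (hg : Computable g) :
    ComputablePred fun a => f a <+: g a :=
  (ComputablePred.eq hf
    (Primrec.list_take.to_comp.comp (Computable.list_length.comp hf) hg)).of_eq fun _ =>
      List.prefix_iff_eq_take.symm

end ComputablePred

/-! ### The standard encoding of the rationals -/

theorem Int.natAbs_eq_half_encode (n : ℤ) : n.natAbs = (encode n + 1) / 2 := by
  cases n with
  | ofNat n =>
    change n = (2 * n + 1) / 2
    omega
  | negSucc n =>
    change n + 1 = (2 * n + 1 + 1) / 2
    omega

theorem Rat.mem_range_encode_iff (e : ℕ) :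
    e ∈ Set.range (@encode ℚ Rat.instEncodable) ↔
      0 < e.unpair.2 ∧ ∀ t < e.unpair.2 + 1,
        ((e.unpair.1 + 1) / 2) % t = 0 → e.unpair.2 % t = 0 → t = 1 := by
  constructor
  · rintro ⟨q, rfl⟩
    change 0 < (Nat.pair (encode q.num) q.den).unpair.2 ∧
      ∀ t < (Nat.pair (encode q.num) q.den).unpair.2 + 1,
        (((Nat.pair (encode q.num) q.den).unpair.1 + 1) / 2) % t = 0 →
          (Nat.pair (encode q.num) q.den).unpair.2 % t = 0 → t = 1
    rw [Nat.unpair_pair, ← Int.natAbs_eq_half_encode]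
    exact ⟨q.den_pos, fun t _ h₁ h₂ => Nat.eq_one_of_dvd_coprimes q.reduced
      (Nat.dvd_of_mod_eq_zero h₁) (Nat.dvd_of_mod_eq_zero h₂)⟩
  · rintro ⟨hpos, hcop⟩
    obtain ⟨n, hn⟩ : ∃ n : ℤ, encode n = e.unpair.1 :=
      ⟨Denumerable.ofNat ℤ e.unpair.1, Denumerable.encode_ofNat _⟩
    rw [← hn, ← Int.natAbs_eq_half_encode] at hcop
    have hred : n.natAbs.Coprime e.unpair.2 :=
      hcop _ (Nat.lt_succ_of_le (Nat.gcd_le_right _ hpos))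
        (Nat.mod_eq_zero_of_dvd (Nat.gcd_dvd_left _ _))
        (Nat.mod_eq_zero_of_dvd (Nat.gcd_dvd_right _ _))
    refine ⟨⟨n, e.unpair.2, hpos.ne', hred⟩, ?_⟩
    change Nat.pair (encode n) e.unpair.2 = e
    rw [hn, Nat.pair_unpair]

theorem computable_nat_pow (b : ℕ) : Computable fun k : ℕ => b ^ k :=
  ((Computable.nat_rec Computable.id (Computable.const 1)
    (Primrec.nat_mul.to_comp.comp (Computable.snd.comp Computable.snd) (Computable.const b)).to₂ :
    Computable fun k : ℕ => Nat.rec (motive := fun _ => ℕ) 1 (fun _ r => r * b) k)).of_eq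
    fun k => by induction k with
      | zero => simp
      | succ n ih => exact (congrArg (· * b) ih).trans (pow_succ b n).symm

theorem computable_inv_pow {b : ℕ} (hb : 0 < b) :
    Computable fun k : ℕ => ((b : ℚ) ^ k)⁻¹ := by
  classical
  have hmem : ComputablePred fun e : ℕ => e ∈ Set.range (@encode ℚ Rat.instEncodable) := by
    have unp₁ : Computable fun e : ℕ => e.unpair.1 := Computable.fst.comp Computable.unpair
    have unp₂ : Computable fun e : ℕ => e.unpair.2 := Computable.snd.comp Computable.unpair
    have half : Computable fun e : ℕ => (e.unpair.1 + 1) / 2 :=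
      Primrec.nat_div.to_comp.comp (Computable.succ.comp unp₁) (Computable.const 2)
    refine (((ComputablePred.lt (Computable.const 0) unp₂).and
      (ComputablePred.forall_lt (p := fun e t => ((e.unpair.1 + 1) / 2) % t = 0 →
        e.unpair.2 % t = 0 → t = 1) ?_ (Computable.succ.comp unp₂)))).of_eq
      fun e => (Rat.mem_range_encode_iff e).symm
    exact (ComputablePred.eq (Primrec.nat_mod.to_comp.comp (half.comp Computable.fst)
      Computable.snd) (Computable.const 0)).imp
      ((ComputablePred.eq (Primrec.nat_mod.to_comp.comp (unp₂.comp Computable.fst)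
      Computable.snd) (Computable.const 0)).imp
      (ComputablePred.eq Computable.snd (Computable.const 1)))
  refine Computable.encode_iff.1 ?_
  have hcode : Computable fun k : ℕ => Nat.pair (encode (1 : ℤ)) (b ^ k) :=
    Primrec₂.natPair.to_comp.comp (Computable.const _) (computable_nat_pow b)
  refine (ComputablePred.count (p := fun (_ : ℕ) e => e ∈ Set.range (@encode ℚ Rat.instEncodable))
    (hmem.comp_computable Computable.snd) hcode).of_eq fun k => ?_
  have hq : @encode ℚ Rat.instEncodable (((b : ℚ) ^ k)⁻¹) = Nat.pair (encode (1 : ℤ)) (b ^ k) := by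
    change Nat.pair (encode (((b : ℚ) ^ k)⁻¹).num) (((b : ℚ) ^ k)⁻¹).den = _
    have : (b : ℚ) ^ k = ((b ^ k : ℕ) : ℚ) := by push_cast; rfl
    have hpos : 0 < b ^ k := by positivity
    rw [this, Rat.inv_natCast_num_of_pos hpos, Rat.inv_natCast_den_of_pos hpos]
  rw [← hq]
  change _ = (letI := @decidableRangeEncode ℚ _
    (List.range (@encode ℚ (Rat.instEncodable) _)).countP
      (· ∈ Set.range (@encode ℚ Rat.instEncodable)))
  rw [Nat.count]
  congr!

/-- Iterated unbounded search: if every state satisfying the invariant has a successor with a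
checkable certificate, and certified successors satisfy the invariant, then a chain of certified
successors is computable uniformly in the parameter. -/
theorem exists_computable_search {α γ δ : Type*} [Primcodable α] [Primcodable γ] [Primcodable δ]
    {Inv : α → γ → Prop} {start : α → γ} {p : α → ℕ → γ → γ → δ → Prop}
    (hstart : Computable start)
    (hp : ComputablePred fun x : (α × ℕ × γ) × (γ × δ) => p x.1.1 x.1.2.1 x.1.2.2 x.2.1 x.2.2)
    (inv_start : ∀ a, Inv a (start a))
    (inv_step : ∀ a m u u' d, p a m u u' d → Inv a u')
    (hex : ∀ a m u, Inv a u → ∃ u' d, p a m u u' d) :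
    ∃ h : α → ℕ → γ, Computable₂ h ∧ (∀ a, h a 0 = start a) ∧
      ∀ a m, ∃ d, p a m (h a m) (h a (m + 1)) d := by
  classical
  let q : α × ℕ × γ → ℕ → Option γ := fun x n =>
    (decode (α := γ × δ) n).bind fun c =>
      cond (decide (p x.1 x.2.1 x.2.2 c.1 c.2)) (some c.1) none
  have hq : Computable₂ q := Computable.bind_decode_iff.2
    (Computable.cond hp.decide (Computable.option_some.comp (Computable.fst.comp Computable.snd))
      (Computable.const none))
  have hsearch := Partrec.rfindOpt hq
  have hrec : Partrec fun x : α × ℕ => (x.2).rec (motive := fun _ => Part γ)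
      (Part.some (start x.1)) fun m IH => IH.bind fun u => Nat.rfindOpt (q (x.1, m, u)) :=
    Partrec.nat_rec Computable.snd (hstart.comp Computable.fst).partrec
      (h := fun (x : α × ℕ) (y : ℕ × γ) => Nat.rfindOpt (q (x.1, y.1, y.2)))
      (hsearch.comp ((Computable.fst.comp Computable.fst).pair
        ((Computable.fst.comp Computable.snd).pair (Computable.snd.comp Computable.snd))))
  set R : α → ℕ → Part γ := fun a m => Nat.rec (motive := fun _ => Part γ)
      (Part.some (start a)) (fun m IH => IH.bind fun u => Nat.rfindOpt (q (a, m, u))) m with hR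
  have hspec : ∀ a m u u', u' ∈ Nat.rfindOpt (q (a, m, u)) → ∃ d, p a m u u' d := by
    intro a m u u' hu
    obtain ⟨n, hn⟩ := Nat.rfindOpt_spec hu
    obtain ⟨c, -, hc⟩ := Option.bind_eq_some_iff.1 hn
    by_cases hpc : p a m u c.1 c.2
    · simp only [hpc, decide_true, cond_true, Option.some.injEq] at hc
      exact ⟨c.2, hc ▸ hpc⟩
    · simp [hpc] at hc
  have hdom : ∀ a m, ∃ u, u ∈ R a m ∧ Inv a u := by
    intro a m
    induction m with
    | zero => exact ⟨start a, Part.mem_some _, inv_start a⟩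
    | succ m ih =>
      obtain ⟨u, hu, hinv⟩ := ih
      obtain ⟨u', d, hd⟩ := hex a m u hinv
      have hD : (Nat.rfindOpt (q (a, m, u))).Dom :=
        Nat.rfindOpt_dom.2 ⟨encode (u', d), u', by simp [q, hd]⟩
      obtain ⟨v, hv⟩ := Part.dom_iff_mem.1 hD
      obtain ⟨d', hd'⟩ := hspec a m u v hv
      exact ⟨v, Part.mem_bind_iff.2 ⟨u, hu, hv⟩, inv_step _ _ _ _ _ hd'⟩
  choose h hh hinv using hdom
  refine ⟨h, hrec.of_eq_tot fun x => hh x.1 x.2, fun a => Part.mem_some_iff.1 (hh a 0),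
    fun a m => ?_⟩
  obtain ⟨u, hu, hv⟩ := Part.mem_bind_iff.1 (hh a (m + 1))
  rw [Part.mem_unique (hh a m) hu]
  exact hspec a m u _ hv

/-! ### Words and cylinders -/

section Cylinders

variable {b : ℕ}

/-- The word formed by the first `s` symbols of `x`. -/
def initialWord (x : ℕ → Fin b) (s : ℕ) : List (Fin b) :=
  List.ofFn fun i : Fin s => x i

@[simp]
theorem length_initialWord (x : ℕ → Fin b) (s : ℕ) : (initialWord x s).length = s := by
  simp [initialWord]

theorem mem_Cyl_iff_getElem {x : ℕ → Fin b} {v : List (Fin b)} :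
    x ∈ Cyl v ↔ ∀ (i : ℕ) (hi : i < v.length), x i = v[i] :=
  ⟨fun h i hi => h ⟨i, hi⟩, fun h i => h i i.2⟩

theorem isPrefix_initialWord_iff {x : ℕ → Fin b} {v : List (Fin b)} {s : ℕ} :
    v <+: initialWord x s ↔ x ∈ Cyl v ∧ v.length ≤ s := by
  rw [mem_Cyl_iff_getElem, List.prefix_iff_getElem]
  constructor
  · rintro ⟨hl, h⟩
    refine ⟨fun i hi => ?_, by simpa using hl⟩
    rw [h i hi]
    simp [initialWord]
  · rintro ⟨h, hl⟩
    refine ⟨by simpa using hl, fun i hi => ?_⟩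
    rw [← h i hi]
    simp [initialWord]

theorem initialWord_eq_iff_mem_Cyl {x : ℕ → Fin b} {v : List (Fin b)} :
    initialWord x v.length = v ↔ x ∈ Cyl v := by
  constructor
  · intro h
    have hv : v <+: initialWord x v.length := by rw [h]
    exact (isPrefix_initialWord_iff.1 hv).1
  · intro h
    exact ((isPrefix_initialWord_iff.2 ⟨h, le_rfl⟩).eq_of_length (by simp)).symm

theorem Cyl_subset_of_isPrefix {u v : List (Fin b)} (h : u <+: v) : Cyl v ⊆ Cyl u := by
  intro x hx
  rw [← initialWord_eq_iff_mem_Cyl] at hx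
  exact (isPrefix_initialWord_iff.1 (hx ▸ h)).1

theorem measurableSet_Cyl (v : List (Fin b)) : MeasurableSet (Cyl v) := by
  rw [Cyl, Set.ofPred_forall]
  exact MeasurableSet.iInter fun i =>
    measurable_pi_apply _ (MeasurableSet.singleton _)

variable {ν : Measure (ℕ → Fin b)}

theorem IsUnifProductMeasure.measure_Cyl (hν : IsUnifProductMeasure b ν) (v : List (Fin b)) :
    ν (Cyl v) = (b : ENNReal)⁻¹ ^ v.length :=
  hν v.length v.get

theorem IsUnifProductMeasure.measure_biUnion_Cyl (hν : IsUnifProductMeasure b ν) {s : ℕ}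
    {T : Finset (List (Fin b))} (hT : ∀ v ∈ T, v.length = s) :
    ν (⋃ v ∈ T, Cyl v) = T.card * (b : ENNReal)⁻¹ ^ s := by
  rw [measure_biUnion_finset _ fun v _ => measurableSet_Cyl v,
    Finset.sum_congr rfl fun v hv => by rw [hν.measure_Cyl, hT v hv], Finset.sum_const,
    nsmul_eq_mul]
  intro v hv v' hv' hne
  refine Set.disjoint_left.2 fun x hx hx' => hne ?_
  rw [← initialWord_eq_iff_mem_Cyl] at hx hx'
  rw [← hx, ← hx', hT v hv, hT v' hv']

theorem inv_pow_lt_mul_inv_pow_iff (hb : 0 < b) {k s c : ℕ} :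
    (b : ENNReal)⁻¹ ^ k < c * (b : ENNReal)⁻¹ ^ s ↔ b ^ s < b ^ k * c := by
  have h₀ : ∀ m, (b : ENNReal) ^ m ≠ 0 := fun m => by simp [hb.ne']
  have h₁ : ∀ m, (b : ENNReal) ^ m ≠ ⊤ := fun m => by finiteness
  rw [← ENNReal.inv_pow, ← ENNReal.inv_pow, ← div_eq_mul_inv,
    ENNReal.lt_div_iff_mul_lt (.inl (h₀ s)) (.inl (h₁ s)), mul_comm, ← div_eq_mul_inv,
    ENNReal.div_lt_iff (.inl (h₀ k)) (.inl (h₁ k)), mul_comm]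
  exact_mod_cast Iff.rfl

end Cylinders

/-! ### Counting encoded objects -/

theorem exists_finset_card_eq_count_encode {β : Type*} [Encodable β] (P : β → Prop)
    [DecidablePred fun e : ℕ => ∃ v, encode v = e ∧ P v] (E : ℕ) :
    ∃ T : Finset β, (∀ v ∈ T, P v) ∧ T.card = Nat.count (fun e => ∃ v, encode v = e ∧ P v) E := by
  classical
  set F := {e ∈ Finset.range E | ∃ v, encode v = e ∧ P v} with hF
  refine ⟨F.preimage encode encode_injective.injOn, fun v hv => ?_, ?_⟩
  · simp only [hF, Finset.mem_preimage, Finset.mem_filter] at hv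
    obtain ⟨-, v', hv', hP⟩ := hv
    exact encode_injective hv' ▸ hP
  · rw [Nat.count_eq_card_filter_range, ← hF,
      ← Finset.card_image_of_injective _ (encode_injective (α := β)), Finset.image_preimage,
      Finset.filter_true_of_mem]
    intro e he
    obtain ⟨-, v, rfl, -⟩ := Finset.mem_filter.1 he
    exact ⟨v, rfl⟩

theorem exists_card_le_count_encode {β : Type*} [Encodable β] (P : β → Prop)
    [DecidablePred fun e : ℕ => ∃ v, encode v = e ∧ P v] (T : Finset β) (hT : ∀ v ∈ T, P v) :
    ∃ E, T.card ≤ Nat.count (fun e => ∃ v, encode v = e ∧ P v) E := by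
  classical
  refine ⟨T.sup encode + 1, ?_⟩
  rw [Nat.count_eq_card_filter_range,
    ← Finset.card_image_of_injective _ (encode_injective (α := β))]
  refine Finset.card_le_card fun e he => ?_
  obtain ⟨v, hv, rfl⟩ := Finset.mem_image.1 he
  exact Finset.mem_filter.2 ⟨Finset.mem_range.2 (Nat.lt_succ_of_le (Finset.le_sup hv)),
    v, rfl, hT v hv⟩

/-! ### Cylinders meeting the tail intersection in positive measure -/

section Tail

variable {b : ℕ} {ν : Measure (ℕ → Fin b)}

/-- The tail intersection `⋂ n ≥ N, U n`. -/
def tailInter {α : Type*} (U : ℕ → Set α) (N : ℕ) : Set α :=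
  {x | ∀ n, N ≤ n → x ∈ U n}

theorem measure_inter_tailInter_ne_zero {α : Type*} [MeasurableSpace α] {μ : Measure α}
    {U : ℕ → Set α} {N N' : ℕ} {B D : Set α} (hDB : D ⊆ B)
    (hDU : ∀ x ∈ D, ∀ n < N', N ≤ n → x ∈ U n) (htail : ∑' i, μ (U (N' + i))ᶜ < μ D) :
    μ (B ∩ tailInter U N) ≠ 0 := by
  intro h₀
  refine htail.not_ge ?_
  calc μ D ≤ μ (B ∩ tailInter U N ∪ ⋃ i, (U (N' + i))ᶜ) := by
        refine measure_mono fun x hx => ?_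
        by_cases h : ∃ i, x ∉ U (N' + i)
        · exact Or.inr (Set.mem_iUnion.2 h)
        · push Not at h
          refine Or.inl ⟨hDB hx, fun n hn => ?_⟩
          rcases lt_or_ge n N' with hn' | hn'
          · exact hDU x hx n hn' hn
          · simpa [Nat.add_sub_cancel' hn'] using h (n - N')
    _ ≤ μ (B ∩ tailInter U N) + μ (⋃ i, (U (N' + i))ᶜ) := measure_union_le _ _
    _ ≤ ∑' i, μ (U (N' + i))ᶜ := by
        rw [h₀, zero_add]
        exact measure_iUnion_le _

/-- The word `v` extends `u`, and for each `n ∈ [N, N')` one of the first `|v|` words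
enumerated by `f n` is a prefix of `v`. -/
def Certifies (f : ℕ → ℕ → List (Fin b)) (N N' : ℕ) (u v : List (Fin b)) : Prop :=
  u <+: v ∧ ∀ n < N', N ≤ n → ∃ i < v.length, f n i <+: v

variable {f : ℕ → ℕ → List (Fin b)} {U : ℕ → Set (ℕ → Fin b)}

theorem Certifies.mono {N N' : ℕ} {u v v' : List (Fin b)} (h : Certifies f N N' u v)
    (hv : v <+: v') : Certifies f N N' u v' := by
  refine ⟨h.1.trans hv, fun n hn hN => ?_⟩
  obtain ⟨i, hi, hp⟩ := h.2 n hn hN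
  exact ⟨i, hi.trans_le hv.length_le, hp.trans hv⟩

theorem exists_certifies_of_mem (hf : ∀ n, U n = ⋃ i, Cyl (f n i)) {N : ℕ} (N' : ℕ)
    {u : List (Fin b)} {x : ℕ → Fin b} (hx : x ∈ Cyl u ∩ tailInter U N) :
    ∃ s, Certifies f N N' u (initialWord x s) := by
  have hex : ∀ n, N ≤ n → ∃ i, x ∈ Cyl (f n i) := fun n hn => by
    have := hx.2 n hn
    rwa [hf, Set.mem_iUnion] at this
  choose! i hi using hex
  let s := u.length + ∑ n ∈ Finset.range N', (i n + 1 + (f n (i n)).length)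
  refine ⟨s, isPrefix_initialWord_iff.2 ⟨hx.1, Nat.le_add_right _ _⟩, fun n hn hN => ?_⟩
  have hle : i n + 1 + (f n (i n)).length ≤ s :=
    (Finset.single_le_sum (f := fun n => i n + 1 + (f n (i n)).length)
      (fun _ _ => Nat.zero_le _) (Finset.mem_range.2 hn)).trans (Nat.le_add_left _ _)
  exact ⟨i n, by rw [length_initialWord]; omega,
    isPrefix_initialWord_iff.2 ⟨hi n hN, by omega⟩⟩

/-- If sufficiently many words of length `s` certify `u`, then the cylinder of `u` meets the tail
intersection in positive measure. -/
theorem measure_Cyl_inter_tailInter_ne_zero (hb : 0 < b) (hν : IsUnifProductMeasure b ν)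
    (hf : ∀ n, U n = ⋃ i, Cyl (f n i)) {N N' k s : ℕ} {u : List (Fin b)}
    (htail : ∑' i, ν (U (N' + i))ᶜ < (b : ENNReal)⁻¹ ^ k) {T : Finset (List (Fin b))}
    (hT : ∀ v ∈ T, v.length = s ∧ Certifies f N N' u v) (hcard : b ^ s < b ^ k * T.card) :
    ν (Cyl u ∩ tailInter U N) ≠ 0 := by
  refine measure_inter_tailInter_ne_zero (D := ⋃ v ∈ T, Cyl v) (N' := N')
    (Set.iUnion₂_subset fun v hv => Cyl_subset_of_isPrefix (hT v hv).2.1) ?_ ?_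
  · intro x hx n hn hN
    obtain ⟨v, hv, hxv⟩ := Set.mem_iUnion₂.1 hx
    obtain ⟨i, -, hi⟩ := (hT v hv).2.2 n hn hN
    rw [hf]
    exact Set.mem_iUnion.2 ⟨i, Cyl_subset_of_isPrefix hi hxv⟩
  · rw [hν.measure_biUnion_Cyl fun v hv => (hT v hv).1]
    exact htail.trans ((inv_pow_lt_mul_inv_pow_iff hb).2 hcard)

theorem exists_finset_certifies (hb : 0 < b) (hν : IsUnifProductMeasure b ν)
    (hf : ∀ n, U n = ⋃ i, Cyl (f n i)) {N k : ℕ} (N' : ℕ) {u : List (Fin b)}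
    (hpos : (b : ENNReal)⁻¹ ^ k < ν (Cyl u ∩ tailInter U N)) :
    ∃ (s : ℕ) (T : Finset (List (Fin b))),
      (∀ v ∈ T, v.length = s ∧ Certifies f N N' u v) ∧ b ^ s < b ^ k * T.card := by
  classical
  let D : ℕ → Set (ℕ → Fin b) := fun s => {x | Certifies f N N' u (initialWord x s)}
  have hmono : Monotone D := fun s s' hs x hx => hx.mono <| isPrefix_initialWord_iff.2
    ⟨initialWord_eq_iff_mem_Cyl.1 (by rw [length_initialWord]), by simpa using hs⟩
  have hlt : (b : ENNReal)⁻¹ ^ k < ν (⋃ s, D s) := hpos.trans_le <| measure_mono fun x hx =>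
    Set.mem_iUnion.2 (exists_certifies_of_mem hf N' hx)
  rw [hmono.measure_iUnion] at hlt
  obtain ⟨s, hs⟩ := lt_iSup_iff.1 hlt
  let T := (List.finite_length_eq (Fin b) s).toFinset.filter (Certifies f N N' u)
  have hT : ∀ v ∈ T, v.length = s ∧ Certifies f N N' u v := fun v hv => by
    simpa [T] using hv
  refine ⟨s, T, hT, ?_⟩
  rw [← inv_pow_lt_mul_inv_pow_iff hb, ← hν.measure_biUnion_Cyl fun v hv => (hT v hv).1]
  refine hs.trans_le (measure_mono fun x hx => Set.mem_iUnion₂.2 ⟨initialWord x s, ?_, ?_⟩)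
  · simpa [T] using show Certifies f N N' u (initialWord x s) from hx
  · exact initialWord_eq_iff_mem_Cyl.1 (by rw [length_initialWord])

theorem exists_extension_measure_ne_zero (hf : ∀ n, U n = ⋃ i, Cyl (f n i)) {N n : ℕ} (hn : N ≤ n)
    {u : List (Fin b)} (hu : ν (Cyl u ∩ tailInter U N) ≠ 0) :
    ∃ (u' : List (Fin b)) (i : ℕ), u <+: u' ∧ u.length < u'.length ∧ f n i <+: u' ∧
      ν (Cyl u' ∩ tailInter U N) ≠ 0 := by
  by_contra! hall
  refine hu (measure_mono_null (t := ⋃ (u' : List (Fin b)) (_ : u <+: u' ∧ u.length < u'.length ∧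
    ∃ i, f n i <+: u'), Cyl u' ∩ tailInter U N) ?_ ?_)
  · intro x hx
    have hxU := hx.2 n hn
    rw [hf] at hxU
    obtain ⟨i, hi⟩ := Set.mem_iUnion.1 hxU
    refine Set.mem_iUnion₂.2 ⟨initialWord x (u.length + 1 + (f n i).length), ⟨?_, ?_, i, ?_⟩,
      initialWord_eq_iff_mem_Cyl.1 (by rw [length_initialWord]), hx.2⟩
    · exact isPrefix_initialWord_iff.2 ⟨hx.1, by omega⟩
    · rw [length_initialWord]; omega
    · exact isPrefix_initialWord_iff.2 ⟨hi, by omega⟩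
  · refine measure_iUnion_null fun u' => measure_iUnion_null ?_
    rintro ⟨h₁, h₂, i, h₃⟩
    exact hall u' i h₁ h₂ h₃

end Tail

theorem computablePred_certifies {α : Type*} [Primcodable α] {b : ℕ}
    {f : ℕ → ℕ → List (Fin b)} (hf : Computable₂ f) {N N' : α → ℕ} {u v : α → List (Fin b)}
    (hN : Computable N) (hN' : Computable N') (hu : Computable u) (hv : Computable v) :
    ComputablePred fun a => Certifies f (N a) (N' a) (u a) (v a) := by
  refine (ComputablePred.isPrefix hu hv).and (ComputablePred.forall_lt
    (p := fun a n => N a ≤ n → ∃ i < (v a).length, f n i <+: v a) ?_ hN')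
  refine (ComputablePred.le (hN.comp Computable.fst) Computable.snd).imp
    (ComputablePred.exists_lt (p := fun (x : α × ℕ) i => f x.2 i <+: v x.1) ?_
      (Computable.list_length.comp (hv.comp Computable.fst)))
  exact ComputablePred.isPrefix
    (hf.comp (Computable.snd.comp Computable.fst) Computable.snd)
    (hv.comp (Computable.fst.comp Computable.fst))

theorem ComputablePred.exists_encode_eq {α β : Type*} [Primcodable α] [Primcodable β]
    {P : α × β → Prop} (hP : ComputablePred P) :
    ComputablePred fun x : α × ℕ => ∃ v, encode v = x.2 ∧ P (x.1, v) := by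
  classical
  have : Computable fun x : α × ℕ =>
      ((decode₂ β x.2).bind fun v => cond (decide (P (x.1, v))) (some ()) none).isSome :=
    Primrec.option_isSome.to_comp.comp (Computable.option_bind
      (Primrec.decode₂.to_comp.comp Computable.snd)
      (Computable.cond (hP.decide.comp ((Computable.fst.comp Computable.fst).pair Computable.snd))
        (Computable.const _) (Computable.const _)).to₂)
  refine (ComputablePred.eq this (Computable.const true)).of_eq fun x => ?_
  simp only [Option.isSome_iff_exists, Option.bind_eq_some_iff]
  constructor
  · rintro ⟨y, v, hv, hc⟩
    refine ⟨v, mem_decode₂.1 hv, ?_⟩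
    by_contra hn
    simp [hn] at hc
  · rintro ⟨v, hv, hp⟩
    exact ⟨(), v, mem_decode₂.2 hv, by simp [hp]⟩

/-- Uniformly in the word `w`, the cylinder of `w` contains a computable point of the
Borel–Cantelli set. -/
theorem ConstructiveBC.exists_computable_selector {b : ℕ} (hb : 2 ≤ b) {ν : Measure (ℕ → Fin b)}
    (hν : IsUnifProductMeasure b ν) {U : ℕ → Set (ℕ → Fin b)} (hU : ConstructiveBC b ν U) :
    ∃ X : List (Fin b) → ℕ → Fin b, Computable₂ X ∧ ∀ w, X w ∈ Cyl w ∧ X w ∈ BCset U := by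
  classical
  obtain ⟨⟨f, hfc, hf⟩, g, hgc, hg⟩ := hU
  have hb0 : 0 < b := by omega
  let G : ℕ → ℕ := fun k => g (((b : ℚ) ^ k)⁻¹)
  have hG : Computable G := hgc.comp (computable_inv_pow hb0)
  have htail : ∀ k, ∑' i, ν (U (G k + i))ᶜ < (b : ENNReal)⁻¹ ^ k := fun k => by
    have hbR : (0 : ℝ) < b := by exact_mod_cast hb0
    have h := hg (((b : ℚ) ^ k)⁻¹) (by positivity)
    have heq : ENNReal.ofReal ((((b : ℚ) ^ k)⁻¹ : ℚ) : ℝ) = (b : ENNReal)⁻¹ ^ k := by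
      push_cast
      rw [ENNReal.ofReal_inv_of_pos (by positivity), ENNReal.ofReal_pow hbR.le,
        ENNReal.ofReal_natCast, ENNReal.inv_pow]
    rwa [heq] at h
  let P : List (Fin b) → ℕ → List (Fin b) → List (Fin b) → ℕ × ℕ × ℕ × ℕ → Prop :=
    fun w m u u' d => u <+: u' ∧ u.length < u'.length ∧ f (G w.length + m) d.1 <+: u' ∧
      b ^ d.2.2.1 < b ^ d.2.1 * Nat.count (fun e => ∃ v, encode v = e ∧
        (v.length = d.2.2.1 ∧ Certifies f (G w.length) (G d.2.1) u' v)) d.2.2.2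
  have hsearch : ∃ h : List (Fin b) → ℕ → List (Fin b), Computable₂ h ∧ (∀ w, h w 0 = w) ∧
      ∀ w m, ∃ d, P w m (h w m) (h w (m + 1)) d := by
    refine exists_computable_search (start := fun w => w)
      (Inv := fun w u => ν (Cyl u ∩ tailInter U (G w.length)) ≠ 0) Computable.id ?_ ?_ ?_ ?_
    · have hw : Computable fun x : (List (Fin b) × ℕ × List (Fin b)) ×
          (List (Fin b) × ℕ × ℕ × ℕ × ℕ) => x.1.1 := Computable.fst.comp Computable.fst
      have hm : Computable fun x : (List (Fin b) × ℕ × List (Fin b)) ×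
          (List (Fin b) × ℕ × ℕ × ℕ × ℕ) => x.1.2.1 :=
        Computable.fst.comp (Computable.snd.comp Computable.fst)
      have hu : Computable fun x : (List (Fin b) × ℕ × List (Fin b)) ×
          (List (Fin b) × ℕ × ℕ × ℕ × ℕ) => x.1.2.2 :=
        Computable.snd.comp (Computable.snd.comp Computable.fst)
      have hu' : Computable fun x : (List (Fin b) × ℕ × List (Fin b)) ×
          (List (Fin b) × ℕ × ℕ × ℕ × ℕ) => x.2.1 := Computable.fst.comp Computable.snd
      have hi : Computable fun x : (List (Fin b) × ℕ × List (Fin b)) ×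
          (List (Fin b) × ℕ × ℕ × ℕ × ℕ) => x.2.2.1 :=
        Computable.fst.comp (Computable.snd.comp Computable.snd)
      have hd : Computable fun x : (List (Fin b) × ℕ × List (Fin b)) ×
          (List (Fin b) × ℕ × ℕ × ℕ × ℕ) => x.2.2.2 :=
        Computable.snd.comp (Computable.snd.comp Computable.snd)
      have hk := Computable.fst.comp hd
      have hs := Computable.fst.comp (Computable.snd.comp hd)
      have hE := Computable.snd.comp (Computable.snd.comp hd)
      have hN := hG.comp (Computable.list_length.comp hw)
      have hcert : ComputablePred fun y : ((List (Fin b) × ℕ × List (Fin b)) ×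
          (List (Fin b) × ℕ × ℕ × ℕ × ℕ)) × List (Fin b) => y.2.length = y.1.2.2.2.2.1 ∧
            Certifies f (G y.1.1.1.length) (G y.1.2.2.2.1) y.1.2.1 y.2 :=
        (ComputablePred.eq (Computable.list_length.comp Computable.snd)
        (hs.comp Computable.fst)).and (computablePred_certifies hfc (hN.comp Computable.fst)
          (hG.comp (hk.comp Computable.fst)) (hu'.comp Computable.fst) Computable.snd)
      have hcode := hcert.exists_encode_eq
      refine (ComputablePred.isPrefix hu hu').and ((ComputablePred.lt
        (Computable.list_length.comp hu) (Computable.list_length.comp hu')).and ((ComputablePred.isPrefix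
          (hfc.comp (Primrec.nat_add.to_comp.comp hN hm) hi) hu').and
          (ComputablePred.lt ((computable_nat_pow b).comp hs)
            (Primrec.nat_mul.to_comp.comp ((computable_nat_pow b).comp hk)
              (ComputablePred.count hcode hE)))))
    · intro w
      refine measure_inter_tailInter_ne_zero (D := Cyl w) (N' := G w.length) subset_rfl
        (fun x _ n hn hN => absurd hn hN.not_gt) ?_
      rw [hν.measure_Cyl]
      exact htail _
    · rintro w m u u' ⟨i, k, s, E⟩ ⟨-, -, -, hcount⟩
      obtain ⟨T, hT, hcard⟩ := exists_finset_card_eq_count_encode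
        (fun v => v.length = s ∧ Certifies f (G w.length) (G k) u' v) E
      exact measure_Cyl_inter_tailInter_ne_zero hb0 hν hf (htail k) hT (hcard ▸ hcount)
    · intro w m u hu
      obtain ⟨u', i, h₁, h₂, h₃, hpos⟩ :=
        exists_extension_measure_ne_zero hf (Nat.le_add_right (G w.length) m) hu
      obtain ⟨k, hk⟩ := ((ENNReal.tendsto_pow_atTop_nhds_zero_of_lt_one
        (ENNReal.inv_lt_one.2 (by exact_mod_cast hb : (1 : ENNReal) < b))).eventually_lt_const
          (pos_iff_ne_zero.2 hpos)).exists
      obtain ⟨s, T, hT, hcard⟩ := exists_finset_certifies hb0 hν hf (G k) hk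
      obtain ⟨E, hE⟩ := exists_card_le_count_encode
        (fun v => v.length = s ∧ Certifies f (G w.length) (G k) u' v) T hT
      exact ⟨u', (i, k, s, E), h₁, h₂, h₃, hcard.trans_le (Nat.mul_le_mul_left _ hE)⟩
  obtain ⟨h, hhc, h0, hstep⟩ := hsearch
  choose d hd using hstep
  have hpre : ∀ w m m', m ≤ m' → h w m <+: h w m' := fun w m m' hm => by
    induction m', hm using Nat.le_induction with
    | base => exact List.prefix_rfl
    | succ n _ ih => exact ih.trans (hd w n).1
  have hlen : ∀ w m, m ≤ (h w m).length := fun w m => by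
    induction m with
    | zero => exact Nat.zero_le _
    | succ n ih => exact ih.trans_lt (hd w n).2.1
  let X : List (Fin b) → ℕ → Fin b := fun w m => ((h w (m + 1))[m]?).getD ⟨0, hb0⟩
  have hX : ∀ w m, X w ∈ Cyl (h w m) := fun w m => by
    rw [mem_Cyl_iff_getElem]
    intro i hi
    have hi' : i < (h w (i + 1)).length := hlen w (i + 1)
    have hval : X w i = (h w (i + 1))[i] := by simp [X, hi']
    rw [hval]
    rcases le_total m (i + 1) with hm | hm
    · exact ((hpre w _ _ hm).getElem hi).symm
    · exact (hpre w _ _ hm).getElem hi'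
  refine ⟨X, ?_, fun w => ⟨by simpa only [h0] using hX w 0, G w.length, fun n hn => ?_⟩⟩
  · exact Computable.option_getD
      (Computable.list_getElem?.comp
        (hhc.comp Computable.fst (Computable.succ.comp Computable.snd)) Computable.snd)
      (Computable.const _)
  · obtain ⟨m, rfl⟩ := Nat.exists_eq_add_of_le hn.le
    rw [hf]
    exact Set.mem_iUnion.2 ⟨_, Cyl_subset_of_isPrefix (hd w m).2.2.1 (hX w (m + 1))⟩

theorem stmt18 (b : ℕ) (hb : 2 ≤ b) (ν : Measure (ℕ → Fin b))
    (hν : IsUnifProductMeasure b ν) (U : ℕ → Set (ℕ → Fin b))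
    (hU : ConstructiveBC b ν U) :
    (∀ w : List (Fin b), ∃ x : ℕ → Fin b,
      Computable x ∧ x ∈ Cyl w ∧ x ∈ BCset U) ∧
    (∃ F : ℕ → ℕ → Fin b, Computable₂ F ∧ (∀ m : ℕ, F m ∈ BCset U) ∧
      Dense (Set.range F)) := by
  obtain ⟨X, hXc, hX⟩ := hU.exists_computable_selector hb hν
  refine ⟨fun w => ⟨X w, hXc.comp (Computable.const w) Computable.id, hX w⟩,
    fun m => X ((decode m).getD []), ?_, fun m => (hX _).2, ?_⟩
  · exact hXc.comp ((Computable.option_getD Computable.decode (Computable.const [])).comp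
      Computable.fst) Computable.snd
  · refine (PiNat.isTopologicalBasis_cylinders fun _ : ℕ => Fin b).dense_iff.2 ?_
    rintro _ ⟨x, n, rfl⟩ -
    refine ⟨X (initialWord x n), fun i hi => ?_, encode (initialWord x n), by simp⟩
    have := mem_Cyl_iff_getElem.1 (hX (initialWord x n)).1 i (by simpa using hi)
    simpa [initialWord] using this
end
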